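/- arXiv:math/0703840 — 2 statements merged into one kernel-verified Lean document; each statement's English description precedes it below -/
import Mathlib

section
/- The maps φ₁, φ₂, φ₃ are pairwise commuting Lie algebra automorphisms of L, each of order exactly 3, and the simultaneous eigenspace decomposition L = ⊕_{(a,b,c)∈ℤ₃³} L_{(a,b,c)}, where L_{(a,b,c)} := {x ∈ L : φ₁(x) = ω^a x, φ₂(x) = ω^b x, φ₃(x) = ω^c x}, is a ℤ₃³-grading of L (i.e. [L_g, L_h] ⊆ L_{g+h}) in which L_{(0,0,0)} = 0 and every component L_{(a,b,c)} with (a,b,c) ≠ (0,0,0) has dimension 3. -/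
noncomputable section

open Matrix
open scoped BigOperators

variable (F : Type*) [Field F] [IsAlgClosed F] [CharZero F]

set_option linter.unusedSectionVars false

/-- `gl₃ = M₃(F)`, the matrix algebra of a 3-dimensional space in a fixed basis. -/
abbrev gl3 := Matrix (Fin 3) (Fin 3) F

/-- Coordinates of a tensor in `X₁ ⊗ X₂ ⊗ X₃` with respect to the fixed bases. -/
abbrev T3 := Fin 3 → Fin 3 → Fin 3 → F

/-- The ambient space `(gl₃)³ × (X₁⊗X₂⊗X₃) × (X₁*⊗X₂*⊗X₃*)` containing the model of e₆. -/
abbrev Mbig := (gl3 F × gl3 F × gl3 F) × (T3 F × T3 F)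

/-- Trace-zero matrices: the coordinate model of `sl(X_i)`. -/
def sl3 : Submodule F (gl3 F) where
  carrier := {g | Matrix.trace g = 0}
  add_mem' := by intro a b ha hb; simp_all [Matrix.trace_add]
  zero_mem' := by simp
  smul_mem' := by intro c a ha; simp_all [Matrix.trace_smul]

lemma mem_sl3 {g : gl3 F} : g ∈ sl3 F ↔ Matrix.trace g = 0 := Iff.rfl

/-- The model of `e₆`: `sl(X₁)⊕sl(X₂)⊕sl(X₃) ⊕ X₁⊗X₂⊗X₃ ⊕ X₁*⊗X₂*⊗X₃*`, as a submodule
of the ambient space. -/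
def Lsub : Submodule F (Mbig F) :=
  ((sl3 F).prod ((sl3 F).prod (sl3 F))).prod
    ((⊤ : Submodule F (T3 F)).prod (⊤ : Submodule F (T3 F)))

/-- The fixed alternating trilinear form: determinant of the matrix with rows `x, y, z`. -/
def det3 (x y z : Fin 3 → F) : F := Matrix.det (Matrix.of ![x, y, z])

/-- The Levi-Civita symbol `ε_{abc} = det(e_a, e_b, e_c)`, encoding the identification
`X∧X ≅ X*` given by `x∧y ↦ det(x,y,−)` (and dually `X*∧X* ≅ X`). -/
def eps (a b c : Fin 3) : F :=
  det3 F (Pi.single a 1) (Pi.single b 1) (Pi.single c 1)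

/-- Coordinates of `[⊗x_i, ⊗y_i] = ⊗(x_i ∧ y_i)` (and of `[⊗f_i, ⊗g_i] = ⊗(f_i ∧ g_i)`). -/
def wedgeT (x y : T3 F) : T3 F := fun c d e =>
  ∑ i, ∑ j, ∑ k, ∑ l, ∑ m, ∑ n,
    x i j k * y l m n * eps F i l c * eps F j m d * eps F k n e

/-- Coordinates of the action of `(g₁,g₂,g₃) ∈ sl(X₁)⊕sl(X₂)⊕sl(X₃)` on `X₁⊗X₂⊗X₃`. -/
def actT (g : gl3 F × gl3 F × gl3 F) (x : T3 F) : T3 F := fun i j k =>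
  (∑ a, g.1 i a * x a j k) + (∑ a, g.2.1 j a * x i a k) + (∑ a, g.2.2 k a * x i j a)

/-- Coordinates of the action of `(g₁,g₂,g₃)` on `X₁*⊗X₂*⊗X₃*` (minus the dual action). -/
def coactT (g : gl3 F × gl3 F × gl3 F) (f : T3 F) : T3 F := fun i j k =>
  -((∑ a, g.1 a i * f a j k) + (∑ a, g.2.1 a j * f i a k) + (∑ a, g.2.2 a k * f i j a))

/-- The full contraction `⟨f, x⟩ = Σ f_{ijk} x_{ijk}`. -/
def tpair (f x : T3 F) : F := ∑ i, ∑ j, ∑ k, f i j k * x i j k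

/-- The `sl(X₁)`-component of `[⊗f_i, ⊗x_i]`. -/
def pair1 (f x : T3 F) : gl3 F := Matrix.of fun r s =>
  (∑ j, ∑ k, f s j k * x r j k) - (1/3 : F) * (if r = s then tpair F f x else 0)

/-- The `sl(X₂)`-component of `[⊗f_i, ⊗x_i]`. -/
def pair2 (f x : T3 F) : gl3 F := Matrix.of fun r s =>
  (∑ i, ∑ k, f i s k * x i r k) - (1/3 : F) * (if r = s then tpair F f x else 0)

/-- The `sl(X₃)`-component of `[⊗f_i, ⊗x_i]`. -/
def pair3 (f x : T3 F) : gl3 F := Matrix.of fun r s =>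
  (∑ i, ∑ j, f i j s * x i j r) - (1/3 : F) * (if r = s then tpair F f x else 0)

/-- The bracket of the model of `e₆`, written out on the ambient coordinate space. -/
def B (u v : Mbig F) : Mbig F :=
  ( ( (u.1.1 * v.1.1 - v.1.1 * u.1.1) + pair1 F u.2.2 v.2.1 - pair1 F v.2.2 u.2.1,
      (u.1.2.1 * v.1.2.1 - v.1.2.1 * u.1.2.1) + pair2 F u.2.2 v.2.1 - pair2 F v.2.2 u.2.1,
      (u.1.2.2 * v.1.2.2 - v.1.2.2 * u.1.2.2) + pair3 F u.2.2 v.2.1 - pair3 F v.2.2 u.2.1 ),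
    ( actT F u.1 v.2.1 - actT F v.1 u.2.1 + wedgeT F u.2.2 v.2.2,
      coactT F u.1 v.2.2 - coactT F v.1 u.2.2 + wedgeT F u.2.1 v.2.1 ) )

lemma trace_pair1 (f x : T3 F) : Matrix.trace (pair1 F f x) = 0 := by
  simp only [pair1, Matrix.trace, Matrix.diag, Matrix.of_apply, if_pos, tpair,
    Finset.sum_sub_distrib, Finset.sum_const, Finset.card_univ, Fintype.card_fin,
    nsmul_eq_mul, Nat.cast_ofNat]
  ring

lemma trace_pair2 (f x : T3 F) : Matrix.trace (pair2 F f x) = 0 := by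
  simp only [pair2, Matrix.trace, Matrix.diag, Matrix.of_apply, if_pos, tpair,
    Finset.sum_sub_distrib, Finset.sum_const, Finset.card_univ, Fintype.card_fin,
    nsmul_eq_mul, Nat.cast_ofNat]
  rw [Finset.sum_comm]
  ring

lemma sum_rotate (h : Fin 3 → Fin 3 → Fin 3 → F) :
    ∑ r, ∑ i, ∑ j, h i j r = ∑ i, ∑ j, ∑ r, h i j r := by
  rw [Finset.sum_comm]
  exact Finset.sum_congr rfl fun i _ => Finset.sum_comm

lemma trace_pair3 (f x : T3 F) : Matrix.trace (pair3 F f x) = 0 := by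
  simp only [pair3, Matrix.trace, Matrix.diag, Matrix.of_apply, if_pos, tpair,
    Finset.sum_sub_distrib, Finset.sum_const, Finset.card_univ, Fintype.card_fin,
    nsmul_eq_mul, Nat.cast_ofNat]
  rw [sum_rotate F (fun i j r => f i j r * x i j r)]
  ring

/-- The bracket takes values in (the ambient copy of) `L`. -/
lemma B_mem (u v : Mbig F) : B F u v ∈ Lsub F := by
  refine ⟨⟨?_, ?_, ?_⟩, trivial, trivial⟩
  · show Matrix.trace ((u.1.1 * v.1.1 - v.1.1 * u.1.1)
        + pair1 F u.2.2 v.2.1 - pair1 F v.2.2 u.2.1) = 0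
    rw [Matrix.trace_sub, Matrix.trace_add, Matrix.trace_sub, trace_pair1, trace_pair1,
      Matrix.trace_mul_comm]
    ring
  · show Matrix.trace ((u.1.2.1 * v.1.2.1 - v.1.2.1 * u.1.2.1)
        + pair2 F u.2.2 v.2.1 - pair2 F v.2.2 u.2.1) = 0
    rw [Matrix.trace_sub, Matrix.trace_add, Matrix.trace_sub, trace_pair2, trace_pair2,
      Matrix.trace_mul_comm]
    ring
  · show Matrix.trace ((u.1.2.2 * v.1.2.2 - v.1.2.2 * u.1.2.2)
        + pair3 F u.2.2 v.2.1 - pair3 F v.2.2 u.2.1) = 0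
    rw [Matrix.trace_sub, Matrix.trace_add, Matrix.trace_sub, trace_pair3, trace_pair3,
      Matrix.trace_mul_comm]
    ring

/-- The bracket of the model of `e₆` on `L` itself. -/
def Bsub (u v : ↥(Lsub F)) : ↥(Lsub F) := ⟨B F ↑u ↑v, B_mem F ↑u ↑v⟩


/-- `φ₁`: the automorphism of the ℤ₃-grading `L = L₀ ⊕ L₁ ⊕ L₂`: identity on `L₀`,
multiplication by `ω` on `L₁` and by `ω²` on `L₂`. -/
def phi1 (ω : F) : Mbig F →ₗ[F] Mbig F where
  toFun u := (u.1, (ω • u.2.1, ω ^ 2 • u.2.2))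
  map_add' u v := by
    ext <;> simp [mul_add]
  map_smul' c u := by
    ext <;> simp [smul_eq_mul] <;> ring

/-- The cyclic shift matrix `P : e_a ↦ e_{a+1}`. -/
def Pcyc : gl3 F := !![0, 0, 1; 1, 0, 0; 0, 1, 0]

/-- `φ₂`: the automorphism extending `u_i⊗v_j⊗w_k ↦ u_{i+1}⊗v_{j+1}⊗w_{k+1}`, acting by
conjugation by the cyclic shift on each `sl(X_i)` and by the inverse-dual maps on `L₂`. -/
def phi2 : Mbig F →ₗ[F] Mbig F where
  toFun u := ((Pcyc F * u.1.1 * (Pcyc F)ᵀ, Pcyc F * u.1.2.1 * (Pcyc F)ᵀ,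
               Pcyc F * u.1.2.2 * (Pcyc F)ᵀ),
              ((fun i j k => u.2.1 (i - 1) (j - 1) (k - 1)),
               (fun i j k => u.2.2 (i - 1) (j - 1) (k - 1))))
  map_add' u v := by
    ext <;> simp [Matrix.mul_add, Matrix.add_mul]
  map_smul' c u := by
    ext <;> simp [Matrix.mul_smul, Matrix.smul_mul]

/-- `φ₃`: the automorphism extending `u_i⊗v_j⊗w_k ↦ ω^{i+j+k}·u_i⊗v_j⊗w_k`, acting by
conjugation by `diag(1,ω,ω²)` on each `sl(X_i)` and by the inverse-dual maps on `L₂`. -/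
def phi3 (ω : F) : Mbig F →ₗ[F] Mbig F where
  toFun u :=
    ((Matrix.diagonal ![1, ω, ω ^ 2] * u.1.1 * Matrix.diagonal ![1, ω ^ 2, ω],
      Matrix.diagonal ![1, ω, ω ^ 2] * u.1.2.1 * Matrix.diagonal ![1, ω ^ 2, ω],
      Matrix.diagonal ![1, ω, ω ^ 2] * u.1.2.2 * Matrix.diagonal ![1, ω ^ 2, ω]),
     ((fun i j k => ω ^ (i.val + j.val + k.val) * u.2.1 i j k),
      (fun i j k => ω ^ (2 * (i.val + j.val + k.val)) * u.2.2 i j k)))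
  map_add' u v := by
    ext <;> simp [Matrix.mul_add, Matrix.add_mul, mul_add] <;> ring
  map_smul' c u := by
    ext <;> simp [Matrix.mul_smul, Matrix.smul_mul, smul_eq_mul] <;> ring

/-- The `c`-eigenspace of an endomorphism of the ambient space. -/
def eigAmb (φ : Mbig F →ₗ[F] Mbig F) (c : F) : Submodule F (Mbig F) :=
  LinearMap.ker (φ - c • LinearMap.id)

/-- `ω^a` for `a : ℤ₃`. -/
def wpow (ω : F) (a : ZMod 3) : F := ω ^ a.val

/-- The homogeneous component `L_{(a,b,c)}` of the `ℤ₃³`-grading of the model of `e₆`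
determined by the commuting automorphisms `φ₁, φ₂, φ₃`. -/
def Lcomp (ω : F) (g : ZMod 3 × ZMod 3 × ZMod 3) : Submodule F ↥(Lsub F) :=
  Submodule.comap (Lsub F).subtype
    (eigAmb F (phi1 F ω) (wpow F ω g.1) ⊓ eigAmb F (phi2 F) (wpow F ω g.2.1) ⊓
      eigAmb F (phi3 F ω) (wpow F ω g.2.2))

section abstractPart

variable {F} {V : Type*} [AddCommGroup V] [Module F V]

lemma w_cube {ω : F} (hω : IsPrimitiveRoot ω 3) : ω ^ 3 = 1 := hω.pow_eq_one

lemma w_sum {ω : F} (hω : IsPrimitiveRoot ω 3) : 1 + ω + ω ^ 2 = 0 := by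
  have h1 : ω ≠ 1 := hω.ne_one (by norm_num)
  have h3 := hω.pow_eq_one
  have : (ω - 1) * (1 + ω + ω ^ 2) = 0 := by linear_combination h3
  rcases mul_eq_zero.mp this with h | h
  · exact absurd (sub_eq_zero.mp h) h1
  · exact h

lemma wpow_cube {ω : F} (hω : IsPrimitiveRoot ω 3) (a : ZMod 3) : wpow F ω a ^ 3 = 1 := by
  unfold wpow
  rw [← pow_mul, mul_comm, pow_mul, hω.pow_eq_one, one_pow]

lemma wpow_add {ω : F} (hω : IsPrimitiveRoot ω 3) (a b : ZMod 3) :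
    wpow F ω (a + b) = wpow F ω a * wpow F ω b := by
  unfold wpow
  rw [← pow_add, ZMod.val_add]
  exact (pow_eq_pow_mod _ hω.pow_eq_one).symm

lemma wpow_inj {ω : F} (hω : IsPrimitiveRoot ω 3) {a b : ZMod 3}
    (h : wpow F ω a = wpow F ω b) : a = b := by
  unfold wpow at h
  exact ZMod.val_injective 3 (hω.pow_inj (ZMod.val_lt a) (ZMod.val_lt b) h)

/-- projection to an eigenspace of an operator of order dividing 3 -/
def pr (ω : F) (φ : V →ₗ[F] V) (a : ZMod 3) : V →ₗ[F] V :=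
  (1/3 : F) • (LinearMap.id + (wpow F ω a) ^ 2 • φ + (wpow F ω a) • (φ ∘ₗ φ))

lemma pr_apply (ω : F) (φ : V →ₗ[F] V) (a : ZMod 3) (x : V) :
    pr ω φ a x = (1/3 : F) • (x + (wpow F ω a) ^ 2 • φ x + (wpow F ω a) • φ (φ x)) := rfl

lemma pr_eig {ω : F} (hω : IsPrimitiveRoot ω 3) (φ : V →ₗ[F] V) (h3 : ∀ x, φ (φ (φ x)) = x)
    (a : ZMod 3) (x : V) : φ (pr ω φ a x) = wpow F ω a • pr ω φ a x := by
  have h := wpow_cube hω a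
  simp only [pr_apply, map_smul, map_add, h3]
  generalize wpow F ω a = w at *
  match_scalars
  · linear_combination (-1/3 : F) * h
  · ring
  · ring

lemma pr_comm (ω : F) (φ ψ : V →ₗ[F] V) (hc : ∀ x, φ (ψ x) = ψ (φ x))
    (a : ZMod 3) (x : V) : φ (pr ω ψ a x) = pr ω ψ a (φ x) := by
  simp only [pr_apply, map_smul, map_add, hc]

lemma pr_sum {ω : F} (hω : IsPrimitiveRoot ω 3) (φ : V →ₗ[F] V) (x : V) :
    ∑ a, pr ω φ a x = x := by
  have h := w_sum hω
  have h3 := w_cube hω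
  have e : ∀ f : ZMod 3 → V, ∑ a, f a = f 0 + f 1 + f 2 := fun f => Fin.sum_univ_three f
  have w0 : wpow F ω 0 = 1 := by simp [wpow]
  have w1 : wpow F ω 1 = ω := by simp [wpow, show ((1 : ZMod 3)).val = 1 from rfl]
  have w2 : wpow F ω 2 = ω ^ 2 := by simp [wpow, show ((2 : ZMod 3)).val = 2 from rfl]
  rw [e]
  simp only [pr_apply, w0, w1, w2]
  match_scalars
  · norm_num
  · linear_combination (1/3 : F) * h + (1/3 : F) * ω * h3
  · linear_combination (1/3 : F) * h

lemma pr_of_eig {ω : F} (hω : IsPrimitiveRoot ω 3) (φ : V →ₗ[F] V) (a b : ZMod 3) (x : V)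
    (hx : φ x = wpow F ω b • x) : pr ω φ a x = if a = b then x else 0 := by
  have ha := wpow_cube hω a
  have hb := wpow_cube hω b
  rw [pr_apply]
  simp only [hx, map_smul]
  split_ifs with h
  · subst h
    generalize wpow F ω a = w at *
    match_scalars
    linear_combination (2/3 : F) * ha
  · have hne : wpow F ω a ≠ wpow F ω b := fun h' => h (wpow_inj hω h')
    generalize wpow F ω a = w at *
    generalize wpow F ω b = v at *
    have hv : w - v ≠ 0 := sub_ne_zero.mpr hne
    have k : w ^ 2 + w * v + v ^ 2 = 0 := by
      have : (w - v) * (w ^ 2 + w * v + v ^ 2) = 0 := by linear_combination ha - hb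
      exact (mul_eq_zero.mp this).resolve_left hv
    match_scalars
    linear_combination (1/3 : F) * v * k - (1/3 : F) * hb

lemma isInternal_of_proj {ι : Type*} [DecidableEq ι] [Fintype ι] (C : ι → Submodule F V)
    (π : ι → V →ₗ[F] V) (hmem : ∀ g x, π g x ∈ C g) (hsum : ∀ x, ∑ g, π g x = x)
    (hid : ∀ g h, ∀ x ∈ C h, π g x = if g = h then x else 0) :
    DirectSum.IsInternal C := by
  constructor
  · rw [injective_iff_map_eq_zero]
    intro x hx
    have key : ∀ (y : DirectSum ι fun i => C i) (g : ι),
        π g (DirectSum.coeAddMonoidHom C y) = y g := by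
      intro y g
      induction y using DirectSum.induction_on with
      | zero => simp
      | of i z =>
        rw [DirectSum.coeAddMonoidHom_of, hid g i z z.2]
        split_ifs with h
        · subst h; simp
        · rw [DirectSum.of_eq_of_ne _ _ _ h]; rfl
      | add a b ha hb => rw [map_add, map_add, ha, hb]; rfl
    refine DFinsupp.ext fun g => ?_
    apply Subtype.ext
    rw [← key x g, hx, map_zero]; rfl
  · intro x
    refine ⟨∑ g, DirectSum.of (fun i => C i) g ⟨π g x, hmem g x⟩, ?_⟩
    rw [map_sum]
    simp only [DirectSum.coeAddMonoidHom_of]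
    exact hsum x

lemma isInternal_three {ω : F} (hω : IsPrimitiveRoot ω 3) (φ₁ φ₂ φ₃ : V →ₗ[F] V)
    (h1 : ∀ x, φ₁ (φ₁ (φ₁ x)) = x) (h2 : ∀ x, φ₂ (φ₂ (φ₂ x)) = x)
    (h3 : ∀ x, φ₃ (φ₃ (φ₃ x)) = x)
    (h12 : ∀ x, φ₁ (φ₂ x) = φ₂ (φ₁ x)) (h13 : ∀ x, φ₁ (φ₃ x) = φ₃ (φ₁ x))
    (h23 : ∀ x, φ₂ (φ₃ x) = φ₃ (φ₂ x))
    (C : ZMod 3 × ZMod 3 × ZMod 3 → Submodule F V)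
    (hC : ∀ g x, x ∈ C g ↔ φ₁ x = wpow F ω g.1 • x ∧ φ₂ x = wpow F ω g.2.1 • x ∧
      φ₃ x = wpow F ω g.2.2 • x) : DirectSum.IsInternal C := by
  refine isInternal_of_proj C
    (fun g => pr ω φ₁ g.1 ∘ₗ pr ω φ₂ g.2.1 ∘ₗ pr ω φ₃ g.2.2) ?_ ?_ ?_
  · intro g x
    rw [hC]
    simp only [LinearMap.comp_apply]
    refine ⟨pr_eig hω _ h1 _ _, ?_, ?_⟩
    · rw [pr_comm ω φ₂ φ₁ (fun x => (h12 x).symm), pr_eig hω _ h2, map_smul]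
    · rw [pr_comm ω φ₃ φ₁ (fun x => (h13 x).symm), pr_comm ω φ₃ φ₂ (fun x => (h23 x).symm),
        pr_eig hω _ h3, map_smul, map_smul]
  · intro x
    simp only [LinearMap.comp_apply]
    rw [Fintype.sum_prod_type]
    simp only [Fintype.sum_prod_type, ← map_sum, pr_sum hω]
  · intro g h x hx
    obtain ⟨e1, e2, e3⟩ := (hC h x).mp hx
    simp only [LinearMap.comp_apply]
    rw [pr_of_eig hω φ₃ _ _ x e3]
    by_cases k3 : g.2.2 = h.2.2
    · rw [if_pos k3, pr_of_eig hω φ₂ _ _ x e2]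
      by_cases k2 : g.2.1 = h.2.1
      · rw [if_pos k2, pr_of_eig hω φ₁ _ _ x e1]
        by_cases k1 : g.1 = h.1
        · rw [if_pos k1, if_pos (Prod.ext k1 (Prod.ext k2 k3))]
        · rw [if_neg k1, if_neg (fun h' => k1 (by rw [h']))]
      · rw [if_neg k2, if_neg (fun h' => k2 (by rw [h'])), map_zero]
    · rw [if_neg k3, if_neg (fun h' => k3 (by rw [h'])), map_zero, map_zero]

lemma finrank_of_internal [FiniteDimensional F V] {ι : Type*} [DecidableEq ι] [Fintype ι]
    (C : ι → Submodule F V) (h : DirectSum.IsInternal C) :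
    Module.finrank F V = ∑ g, Module.finrank F (C g) := by
  rw [← (LinearEquiv.ofBijective (DirectSum.coeLinearMap C) h).finrank_eq,
    Module.finrank_directSum]

end abstractPart

section concretePart

variable {F}

lemma pcyc_conj (g : gl3 F) (i j : Fin 3) :
    (Pcyc F * g * (Pcyc F)ᵀ) i j = g (i - 1) (j - 1) := by
  have e : ∀ i a : Fin 3, Pcyc F i a = if a = i - 1 then 1 else 0 := by
    intro i a; fin_cases i <;> fin_cases a <;> simp [Pcyc] <;> decide
  simp only [Matrix.mul_apply, Matrix.transpose_apply, e]
  simp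

lemma diag_conj {ω : F} (hω : IsPrimitiveRoot ω 3) (g : gl3 F) (i j : Fin 3) :
    (Matrix.diagonal ![1, ω, ω ^ 2] * g * Matrix.diagonal ![1, ω ^ 2, ω]) i j
      = ω ^ i.val * ω ^ (2 * j.val) * g i j := by
  have h := w_cube hω
  rw [Matrix.mul_diagonal, Matrix.diagonal_mul]
  have e1 : (![1, ω, ω ^ 2] : Fin 3 → F) i = ω ^ i.val := by fin_cases i <;> simp
  have e2 : (![1, ω ^ 2, ω] : Fin 3 → F) j = ω ^ (2 * j.val) := by
    fin_cases j <;> simp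
    linear_combination (-ω) * h
  rw [e1, e2]; ring

/-- coordinatewise extensionality -/
lemma mbig_ext {u v : Mbig F} (h1 : ∀ i j, u.1.1 i j = v.1.1 i j)
    (h2 : ∀ i j, u.1.2.1 i j = v.1.2.1 i j) (h3 : ∀ i j, u.1.2.2 i j = v.1.2.2 i j)
    (h4 : ∀ i j k, u.2.1 i j k = v.2.1 i j k) (h5 : ∀ i j k, u.2.2 i j k = v.2.2 i j k) :
    u = v := by
  refine Prod.ext (Prod.ext ?_ (Prod.ext ?_ ?_)) (Prod.ext ?_ ?_)
  · ext i j; exact h1 i j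
  · ext i j; exact h2 i j
  · ext i j; exact h3 i j
  · funext i j k; exact h4 i j k
  · funext i j k; exact h5 i j k

/-- relabelled matrix, conjugation by the cyclic shift -/
def shM (g : gl3 F) : gl3 F := Matrix.of fun i j => g (i - 1) (j - 1)
/-- shifted tensor -/
def shT (x : T3 F) : T3 F := fun i j k => x (i - 1) (j - 1) (k - 1)
/-- matrix conjugated by the diagonal -/
def dgM (ω : F) (g : gl3 F) : gl3 F := Matrix.of fun i j => ω ^ i.val * ω ^ (2 * j.val) * g i j
/-- rescaled tensor -/
def dgT (ω : F) (x : T3 F) : T3 F := fun i j k => ω ^ (i.val + j.val + k.val) * x i j k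
/-- dually rescaled tensor -/
def dgS (ω : F) (x : T3 F) : T3 F := fun i j k => ω ^ (2 * (i.val + j.val + k.val)) * x i j k

lemma phi1_eq (ω : F) (u : Mbig F) : phi1 F ω u = (u.1, (ω • u.2.1, ω ^ 2 • u.2.2)) := rfl

lemma phi2_eq (u : Mbig F) :
    phi2 F u = ((shM u.1.1, shM u.1.2.1, shM u.1.2.2), (shT u.2.1, shT u.2.2)) :=
  mbig_ext (fun i j => pcyc_conj _ i j) (fun i j => pcyc_conj _ i j)
    (fun i j => pcyc_conj _ i j) (fun _ _ _ => rfl) (fun _ _ _ => rfl)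

lemma phi3_eq {ω : F} (hω : IsPrimitiveRoot ω 3) (u : Mbig F) :
    phi3 F ω u = ((dgM ω u.1.1, dgM ω u.1.2.1, dgM ω u.1.2.2), (dgT ω u.2.1, dgS ω u.2.2)) :=
  mbig_ext (fun i j => diag_conj hω _ i j) (fun i j => diag_conj hω _ i j)
    (fun i j => diag_conj hω _ i j) (fun _ _ _ => rfl) (fun _ _ _ => rfl)

lemma sum_shift (f : Fin 3 → F) : ∑ i, f (i - 1) = ∑ i, f i :=
  Equiv.sum_comp (Equiv.subRight (1 : Fin 3)) f

lemma sum_shift2 (f : Fin 3 → Fin 3 → F) : ∑ i, ∑ j, f (i - 1) (j - 1) = ∑ i, ∑ j, f i j := by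
  rw [← sum_shift (fun i => ∑ j, f i j)]
  exact Finset.sum_congr rfl fun i _ => sum_shift _

lemma sum_shift3 (f : Fin 3 → Fin 3 → Fin 3 → F) :
    ∑ i, ∑ j, ∑ k, f (i - 1) (j - 1) (k - 1) = ∑ i, ∑ j, ∑ k, f i j k := by
  rw [← sum_shift (fun i => ∑ j, ∑ k, f i j k)]
  exact Finset.sum_congr rfl fun i _ => sum_shift2 _

lemma sum_shift6 (f : Fin 3 → Fin 3 → Fin 3 → Fin 3 → Fin 3 → Fin 3 → F) :
    ∑ i, ∑ j, ∑ k, ∑ l, ∑ m, ∑ n, f (i - 1) (j - 1) (k - 1) (l - 1) (m - 1) (n - 1)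
      = ∑ i, ∑ j, ∑ k, ∑ l, ∑ m, ∑ n, f i j k l m n := by
  rw [← sum_shift3 (fun i j k => ∑ l, ∑ m, ∑ n, f i j k l m n)]
  exact Finset.sum_congr rfl fun i _ => Finset.sum_congr rfl fun j _ =>
    Finset.sum_congr rfl fun k _ => sum_shift3 _

lemma eps_val (a b c : Fin 3) : eps F a b c =
    (((((b.val : ℤ) - a.val) * ((c.val : ℤ) - b.val) * ((c.val : ℤ) - a.val) / 2 : ℤ)) : F) := by
  fin_cases a <;> fin_cases b <;> fin_cases c <;>
    simp [eps, det3, Matrix.det_fin_three, Pi.single_apply]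

lemma eps_shift (a b c : Fin 3) : eps F (a - 1) (b - 1) (c - 1) = eps F a b c := by
  rw [eps_val, eps_val]
  congr 1
  revert a b c; decide

lemma eps_dg {ω : F} (hω : IsPrimitiveRoot ω 3) (a b c : Fin 3) :
    ω ^ a.val * ω ^ b.val * eps F a b c = ω ^ (2 * c.val) * eps F a b c := by
  rw [eps_val]
  by_cases h : ((b.val : ℤ) - a.val) * ((c.val : ℤ) - b.val) * ((c.val : ℤ) - a.val) / 2 = 0
  · rw [h]; simp
  · have : (a.val + b.val) % 3 = (2 * c.val) % 3 := by revert a b c; decide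
    rw [← pow_add, pow_eq_pow_mod _ hω.pow_eq_one, this, ← pow_eq_pow_mod _ hω.pow_eq_one]

lemma wedge_smul (s t : F) (x y : T3 F) :
    wedgeT F (s • x) (t • y) = (s * t) • wedgeT F x y := by
  funext c d e
  simp only [wedgeT, Pi.smul_apply, smul_eq_mul, Finset.mul_sum]
  refine Finset.sum_congr rfl fun i _ => Finset.sum_congr rfl fun j _ =>
    Finset.sum_congr rfl fun k _ => Finset.sum_congr rfl fun l _ =>
    Finset.sum_congr rfl fun m _ => Finset.sum_congr rfl fun n _ => ?_
  ring

lemma tpair_smul (s t : F) (x y : T3 F) : tpair F (s • x) (t • y) = (s * t) * tpair F x y := by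
  simp only [tpair, Pi.smul_apply, smul_eq_mul, Finset.mul_sum]
  refine Finset.sum_congr rfl fun i _ => Finset.sum_congr rfl fun j _ =>
    Finset.sum_congr rfl fun k _ => ?_
  ring

lemma pair1_smul (s t : F) (x y : T3 F) :
    pair1 F (s • x) (t • y) = (s * t) • pair1 F x y := by
  ext r c
  simp only [pair1, tpair_smul, Matrix.of_apply, Matrix.smul_apply, Pi.smul_apply, smul_eq_mul,
    mul_sub, Finset.mul_sum]
  congr 1
  · exact Finset.sum_congr rfl fun i _ => Finset.sum_congr rfl fun j _ => by ring
  · split_ifs <;> ring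

lemma pair2_smul (s t : F) (x y : T3 F) :
    pair2 F (s • x) (t • y) = (s * t) • pair2 F x y := by
  ext r c
  simp only [pair2, tpair_smul, Matrix.of_apply, Matrix.smul_apply, Pi.smul_apply, smul_eq_mul,
    mul_sub, Finset.mul_sum]
  congr 1
  · exact Finset.sum_congr rfl fun i _ => Finset.sum_congr rfl fun j _ => by ring
  · split_ifs <;> ring

lemma pair3_smul (s t : F) (x y : T3 F) :
    pair3 F (s • x) (t • y) = (s * t) • pair3 F x y := by
  ext r c
  simp only [pair3, tpair_smul, Matrix.of_apply, Matrix.smul_apply, Pi.smul_apply, smul_eq_mul,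
    mul_sub, Finset.mul_sum]
  congr 1
  · exact Finset.sum_congr rfl fun i _ => Finset.sum_congr rfl fun j _ => by ring
  · split_ifs <;> ring

lemma actT_smul (s t : F) (g : gl3 F × gl3 F × gl3 F) (x : T3 F) :
    actT F (s • g) (t • x) = (s * t) • actT F g x := by
  funext i j k
  simp only [actT, Pi.smul_apply, Prod.smul_fst, Prod.smul_snd, Matrix.smul_apply, smul_eq_mul,
    Fin.sum_univ_three]
  ring

lemma coactT_smul (s t : F) (g : gl3 F × gl3 F × gl3 F) (x : T3 F) :
    coactT F (s • g) (t • x) = (s * t) • coactT F g x := by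
  funext i j k
  simp only [coactT, Pi.smul_apply, Prod.smul_fst, Prod.smul_snd, Matrix.smul_apply, smul_eq_mul,
    Fin.sum_univ_three]
  ring

lemma B_smul (s t : F) (u v : Mbig F) : B F (s • u) (t • v) = (s * t) • B F u v := by
  simp only [B, Prod.smul_fst, Prod.smul_snd, pair1_smul, pair2_smul, pair3_smul, actT_smul,
    coactT_smul, wedge_smul, Matrix.smul_mul, Matrix.mul_smul, smul_smul, mul_comm t s,
    Prod.smul_mk, smul_add, smul_sub]

lemma phi1_B {ω : F} (hω : IsPrimitiveRoot ω 3) (u v : Mbig F) :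
    phi1 F ω (B F u v) = B F (phi1 F ω u) (phi1 F ω v) := by
  have h := w_cube hω
  have h1 : ω ^ 2 * ω = 1 := by linear_combination h
  have h2 : ω ^ 2 * ω ^ 2 = ω := by linear_combination ω * h
  have a1 : ∀ (g : gl3 F × gl3 F × gl3 F) (x : T3 F) (t : F),
      actT F g (t • x) = t • actT F g x := by
    intro g x t; simpa using actT_smul 1 t g x
  have a2 : ∀ (g : gl3 F × gl3 F × gl3 F) (x : T3 F) (t : F),
      coactT F g (t • x) = t • coactT F g x := by
    intro g x t; simpa using coactT_smul 1 t g x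
  simp only [phi1_eq, B, pair1_smul, pair2_smul, pair3_smul, wedge_smul, a1, a2, h1, h2,
    one_smul, smul_add, smul_sub, ← pow_two]

lemma shM_mul (g h : gl3 F) : shM (g * h) = shM g * shM h := by
  ext i j
  simp only [shM, Matrix.of_apply, Matrix.mul_apply]
  exact (sum_shift fun k => g (i - 1) k * h k (j - 1)).symm

lemma tpair_sh (x y : T3 F) : tpair F (shT x) (shT y) = tpair F x y :=
  sum_shift3 fun i j k => x i j k * y i j k

lemma pair1_sh (x y : T3 F) : shM (pair1 F x y) = pair1 F (shT x) (shT y) := by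
  ext r s
  simp only [shM, pair1, tpair_sh, Matrix.of_apply, sub_left_inj]
  exact (sum_shift2 fun j k => x (s - 1) j k * y (r - 1) j k).symm

lemma pair2_sh (x y : T3 F) : shM (pair2 F x y) = pair2 F (shT x) (shT y) := by
  ext r s
  simp only [shM, pair2, tpair_sh, Matrix.of_apply, sub_left_inj]
  exact (sum_shift2 fun j k => x j (s - 1) k * y j (r - 1) k).symm

lemma pair3_sh (x y : T3 F) : shM (pair3 F x y) = pair3 F (shT x) (shT y) := by
  ext r s
  simp only [shM, pair3, tpair_sh, Matrix.of_apply, sub_left_inj]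
  exact (sum_shift2 fun j k => x j k (s - 1) * y j k (r - 1)).symm

lemma wedge_sh (x y : T3 F) : shT (wedgeT F x y) = wedgeT F (shT x) (shT y) := by
  funext c d e
  simp only [shT, wedgeT]
  rw [← sum_shift6]
  simp only [eps_shift]

lemma actT_sh (g : gl3 F × gl3 F × gl3 F) (x : T3 F) :
    shT (actT F g x) = actT F (shM g.1, shM g.2.1, shM g.2.2) (shT x) := by
  funext i j k
  simp only [shT, shM, actT, Matrix.of_apply]
  rw [sum_shift fun a => g.1 (i - 1) a * x a (j - 1) (k - 1),
    sum_shift fun a => g.2.1 (j - 1) a * x (i - 1) a (k - 1),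
    sum_shift fun a => g.2.2 (k - 1) a * x (i - 1) (j - 1) a]

lemma coactT_sh (g : gl3 F × gl3 F × gl3 F) (x : T3 F) :
    shT (coactT F g x) = coactT F (shM g.1, shM g.2.1, shM g.2.2) (shT x) := by
  funext i j k
  simp only [shT, shM, coactT, Matrix.of_apply]
  rw [sum_shift fun a => g.1 a (i - 1) * x a (j - 1) (k - 1),
    sum_shift fun a => g.2.1 a (j - 1) * x (i - 1) a (k - 1),
    sum_shift fun a => g.2.2 a (k - 1) * x (i - 1) (j - 1) a]

lemma shM_add (g h : gl3 F) : shM (g + h) = shM g + shM h := rfl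
lemma shM_sub (g h : gl3 F) : shM (g - h) = shM g - shM h := rfl
lemma shT_add (g h : T3 F) : shT (g + h) = shT g + shT h := rfl
lemma shT_sub (g h : T3 F) : shT (g - h) = shT g - shT h := rfl

lemma phi2_B (u v : Mbig F) : phi2 F (B F u v) = B F (phi2 F u) (phi2 F v) := by
  simp only [phi2_eq, B, shM_add, shM_sub, shT_add, shT_sub, shM_mul, pair1_sh, pair2_sh,
    pair3_sh, wedge_sh, actT_sh, coactT_sh]

lemma w_unit {ω : F} (hω : IsPrimitiveRoot ω 3) (n : ℕ) : ω ^ n * ω ^ (2 * n) = 1 := by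
  rw [← pow_add, show n + 2 * n = 3 * n by ring, pow_mul, hω.pow_eq_one, one_pow]

lemma dgM_mul {ω : F} (hω : IsPrimitiveRoot ω 3) (g h : gl3 F) :
    dgM ω (g * h) = dgM ω g * dgM ω h := by
  ext i j
  simp only [dgM, Matrix.of_apply, Matrix.mul_apply, Finset.mul_sum]
  refine Finset.sum_congr rfl fun k _ => ?_
  linear_combination (-(ω ^ i.val * ω ^ (2 * j.val) * g i k * h k j)) * w_unit hω k.val

lemma tpair_dg {ω : F} (hω : IsPrimitiveRoot ω 3) (x y : T3 F) :
    tpair F (dgS ω x) (dgT ω y) = tpair F x y := by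
  simp only [tpair, dgS, dgT]
  refine Finset.sum_congr rfl fun i _ => Finset.sum_congr rfl fun j _ =>
    Finset.sum_congr rfl fun k _ => ?_
  linear_combination (x i j k * y i j k) * w_unit hω (i.val + j.val + k.val)

lemma diag_part {ω : F} (hω : IsPrimitiveRoot ω 3) (r s : Fin 3) (t : F) :
    ω ^ r.val * ω ^ (2 * s.val) * ((1/3 : F) * (if r = s then t else 0))
      = (1/3 : F) * (if r = s then t else 0) := by
  split_ifs with h
  · subst h; rw [w_unit hω, one_mul]
  · simp

lemma pair1_dg {ω : F} (hω : IsPrimitiveRoot ω 3) (x y : T3 F) :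
    dgM ω (pair1 F x y) = pair1 F (dgS ω x) (dgT ω y) := by
  ext r s
  simp only [dgM, pair1, tpair_dg hω, Matrix.of_apply, mul_sub, diag_part hω]
  congr 1
  simp only [dgS, dgT, Finset.mul_sum]
  refine Finset.sum_congr rfl fun j _ => Finset.sum_congr rfl fun k _ => ?_
  have := w_unit hω (j.val + k.val)
  simp only [mul_add, pow_add] at this ⊢
  linear_combination (-(ω ^ r.val * ω ^ (2 * s.val) * x s j k * y r j k)) * this

lemma pair2_dg {ω : F} (hω : IsPrimitiveRoot ω 3) (x y : T3 F) :
    dgM ω (pair2 F x y) = pair2 F (dgS ω x) (dgT ω y) := by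
  ext r s
  simp only [dgM, pair2, tpair_dg hω, Matrix.of_apply, mul_sub, diag_part hω]
  congr 1
  simp only [dgS, dgT, Finset.mul_sum]
  refine Finset.sum_congr rfl fun j _ => Finset.sum_congr rfl fun k _ => ?_
  have := w_unit hω (j.val + k.val)
  simp only [mul_add, pow_add] at this ⊢
  linear_combination (-(ω ^ r.val * ω ^ (2 * s.val) * x j s k * y j r k)) * this

lemma pair3_dg {ω : F} (hω : IsPrimitiveRoot ω 3) (x y : T3 F) :
    dgM ω (pair3 F x y) = pair3 F (dgS ω x) (dgT ω y) := by
  ext r s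
  simp only [dgM, pair3, tpair_dg hω, Matrix.of_apply, mul_sub, diag_part hω]
  congr 1
  simp only [dgS, dgT, Finset.mul_sum]
  refine Finset.sum_congr rfl fun j _ => Finset.sum_congr rfl fun k _ => ?_
  have := w_unit hω (j.val + k.val)
  simp only [mul_add, pow_add] at this ⊢
  linear_combination (-(ω ^ r.val * ω ^ (2 * s.val) * x j k s * y j k r)) * this

lemma eps_dg2 {ω : F} (hω : IsPrimitiveRoot ω 3) (a b c : Fin 3) :
    ω ^ (2 * a.val) * ω ^ (2 * b.val) * eps F a b c = ω ^ c.val * eps F a b c := by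
  have h1 := eps_dg hω a b c
  have ha := w_unit hω a.val
  have hb := w_unit hω b.val
  have hc := w_unit hω c.val
  calc ω ^ (2 * a.val) * ω ^ (2 * b.val) * eps F a b c
      = (ω ^ c.val * ω ^ (2 * a.val) * ω ^ (2 * b.val)) *
          (ω ^ (2 * c.val) * eps F a b c) := by
        linear_combination (-(ω ^ (2 * a.val) * ω ^ (2 * b.val) * eps F a b c)) * hc
    _ = (ω ^ c.val * ω ^ (2 * a.val) * ω ^ (2 * b.val)) *
          (ω ^ a.val * ω ^ b.val * eps F a b c) := by rw [h1]
    _ = (ω ^ a.val * ω ^ (2 * a.val)) * (ω ^ b.val * ω ^ (2 * b.val)) *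
          (ω ^ c.val * eps F a b c) := by ring
    _ = _ := by rw [ha, hb]; ring

lemma wedge_dgT {ω : F} (hω : IsPrimitiveRoot ω 3) (x y : T3 F) :
    dgS ω (wedgeT F x y) = wedgeT F (dgT ω x) (dgT ω y) := by
  funext c d e
  simp only [dgS, dgT, wedgeT, Finset.mul_sum]
  refine Finset.sum_congr rfl fun i _ => Finset.sum_congr rfl fun j _ =>
    Finset.sum_congr rfl fun k _ => Finset.sum_congr rfl fun l _ =>
    Finset.sum_congr rfl fun m _ => Finset.sum_congr rfl fun n _ => ?_
  simp only [mul_add, pow_add]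
  calc _ = x i j k * y l m n * (ω ^ (2 * c.val) * eps F i l c) *
        (ω ^ (2 * d.val) * eps F j m d) * (ω ^ (2 * e.val) * eps F k n e) := by ring
    _ = _ := by rw [← eps_dg hω i l c, ← eps_dg hω j m d, ← eps_dg hω k n e]; ring

lemma wedge_dgS {ω : F} (hω : IsPrimitiveRoot ω 3) (x y : T3 F) :
    dgT ω (wedgeT F x y) = wedgeT F (dgS ω x) (dgS ω y) := by
  funext c d e
  simp only [dgS, dgT, wedgeT, Finset.mul_sum]
  refine Finset.sum_congr rfl fun i _ => Finset.sum_congr rfl fun j _ =>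
    Finset.sum_congr rfl fun k _ => Finset.sum_congr rfl fun l _ =>
    Finset.sum_congr rfl fun m _ => Finset.sum_congr rfl fun n _ => ?_
  simp only [mul_add, pow_add]
  calc _ = x i j k * y l m n * (ω ^ c.val * eps F i l c) *
        (ω ^ d.val * eps F j m d) * (ω ^ e.val * eps F k n e) := by ring
    _ = _ := by rw [← eps_dg2 hω i l c, ← eps_dg2 hω j m d, ← eps_dg2 hω k n e]; ring

lemma actT_dg {ω : F} (hω : IsPrimitiveRoot ω 3) (g : gl3 F × gl3 F × gl3 F) (x : T3 F) :
    dgT ω (actT F g x) = actT F (dgM ω g.1, dgM ω g.2.1, dgM ω g.2.2) (dgT ω x) := by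
  funext i j k
  simp only [dgT, dgM, actT, Matrix.of_apply, mul_add, Finset.mul_sum]
  congr 1
  · congr 1
    · refine Finset.sum_congr rfl fun a _ => ?_
      simp only [pow_add]
      linear_combination (-(ω ^ i.val * ω ^ j.val * ω ^ k.val * g.1 i a * x a j k)) *
        w_unit hω a.val
    · refine Finset.sum_congr rfl fun a _ => ?_
      simp only [pow_add]
      linear_combination (-(ω ^ i.val * ω ^ j.val * ω ^ k.val * g.2.1 j a * x i a k)) *
        w_unit hω a.val
  · refine Finset.sum_congr rfl fun a _ => ?_
    simp only [pow_add]
    linear_combination (-(ω ^ i.val * ω ^ j.val * ω ^ k.val * g.2.2 k a * x i j a)) *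
      w_unit hω a.val

lemma coactT_dg {ω : F} (hω : IsPrimitiveRoot ω 3) (g : gl3 F × gl3 F × gl3 F) (x : T3 F) :
    dgS ω (coactT F g x) = coactT F (dgM ω g.1, dgM ω g.2.1, dgM ω g.2.2) (dgS ω x) := by
  funext i j k
  simp only [dgS, dgM, coactT, Matrix.of_apply, mul_neg, neg_inj]
  rw [mul_add (ω ^ _), mul_add (ω ^ _), Finset.mul_sum, Finset.mul_sum, Finset.mul_sum]
  congr 1
  · congr 1
    · refine Finset.sum_congr rfl fun a _ => ?_
      simp only [pow_add, mul_add]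
      linear_combination (-(ω ^ (2 * i.val) * ω ^ (2 * j.val) * ω ^ (2 * k.val) *
        g.1 a i * x a j k)) * w_unit hω a.val
    · refine Finset.sum_congr rfl fun a _ => ?_
      simp only [pow_add, mul_add]
      linear_combination (-(ω ^ (2 * i.val) * ω ^ (2 * j.val) * ω ^ (2 * k.val) *
        g.2.1 a j * x i a k)) * w_unit hω a.val
  · refine Finset.sum_congr rfl fun a _ => ?_
    simp only [pow_add, mul_add]
    linear_combination (-(ω ^ (2 * i.val) * ω ^ (2 * j.val) * ω ^ (2 * k.val) *
        g.2.2 a k * x i j a)) * w_unit hω a.val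

lemma dgM_add (ω : F) (g h : gl3 F) : dgM ω (g + h) = dgM ω g + dgM ω h := by
  ext i j; simp [dgM, mul_add]
lemma dgM_sub (ω : F) (g h : gl3 F) : dgM ω (g - h) = dgM ω g - dgM ω h := by
  ext i j; simp [dgM, mul_sub]
lemma dgT_add (ω : F) (g h : T3 F) : dgT ω (g + h) = dgT ω g + dgT ω h := by
  funext i j k; simp [dgT, mul_add]
lemma dgT_sub (ω : F) (g h : T3 F) : dgT ω (g - h) = dgT ω g - dgT ω h := by
  funext i j k; simp [dgT, mul_sub]
lemma dgS_add (ω : F) (g h : T3 F) : dgS ω (g + h) = dgS ω g + dgS ω h := by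
  funext i j k; simp [dgS, mul_add]
lemma dgS_sub (ω : F) (g h : T3 F) : dgS ω (g - h) = dgS ω g - dgS ω h := by
  funext i j k; simp [dgS, mul_sub]

lemma phi3_B {ω : F} (hω : IsPrimitiveRoot ω 3) (u v : Mbig F) :
    phi3 F ω (B F u v) = B F (phi3 F ω u) (phi3 F ω v) := by
  simp only [phi3_eq hω, B, dgM_add, dgM_sub, dgT_add, dgT_sub, dgS_add, dgS_sub, dgM_mul hω,
    pair1_dg hω, pair2_dg hω, pair3_dg hω, wedge_dgT hω, wedge_dgS hω, actT_dg hω, coactT_dg hω]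

lemma mem_Lsub (u : Mbig F) : u ∈ Lsub F ↔
    Matrix.trace u.1.1 = 0 ∧ Matrix.trace u.1.2.1 = 0 ∧ Matrix.trace u.1.2.2 = 0 := by
  constructor
  · rintro ⟨⟨h1, h2, h3⟩, -⟩; exact ⟨h1, h2, h3⟩
  · rintro ⟨h1, h2, h3⟩; exact ⟨⟨h1, h2, h3⟩, trivial, trivial⟩

lemma trace_shM (g : gl3 F) : Matrix.trace (shM g) = Matrix.trace g :=
  sum_shift fun i => g i i

lemma trace_dgM {ω : F} (hω : IsPrimitiveRoot ω 3) (g : gl3 F) :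
    Matrix.trace (dgM ω g) = Matrix.trace g := by
  simp only [Matrix.trace, Matrix.diag, dgM, Matrix.of_apply, w_unit hω, one_mul]

lemma phi1_mem (ω : F) (u : Mbig F) (h : u ∈ Lsub F) : phi1 F ω u ∈ Lsub F := by
  rw [mem_Lsub] at h ⊢; exact h

lemma phi2_mem (u : Mbig F) (h : u ∈ Lsub F) : phi2 F u ∈ Lsub F := by
  rw [mem_Lsub] at h ⊢; simpa only [phi2_eq, trace_shM] using h

lemma phi3_mem {ω : F} (hω : IsPrimitiveRoot ω 3) (u : Mbig F) (h : u ∈ Lsub F) :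
    phi3 F ω u ∈ Lsub F := by
  rw [mem_Lsub] at h ⊢; simpa only [phi3_eq hω, trace_dgM hω] using h

lemma phi1_cube {ω : F} (hω : IsPrimitiveRoot ω 3) (u : Mbig F) :
    phi1 F ω (phi1 F ω (phi1 F ω u)) = u := by
  have h := w_cube hω
  refine mbig_ext (fun _ _ => rfl) (fun _ _ => rfl) (fun _ _ => rfl) ?_ ?_
  · intro i j k
    simp only [phi1_eq, Pi.smul_apply, smul_eq_mul]
    linear_combination u.2.1 i j k * h
  · intro i j k
    simp only [phi1_eq, Pi.smul_apply, smul_eq_mul]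
    linear_combination u.2.2 i j k * (ω ^ 3 + 1) * h

lemma sub_three (i : Fin 3) : i - 1 - 1 - 1 = i := by revert i; decide

lemma phi2_cube (u : Mbig F) : phi2 F (phi2 F (phi2 F u)) = u := by
  refine mbig_ext ?_ ?_ ?_ ?_ ?_ <;> intros <;>
    simp only [phi2_eq, shM, shT, Matrix.of_apply, sub_three]

lemma pow3 {ω : F} (hω : IsPrimitiveRoot ω 3) (n : ℕ) : (ω ^ n) ^ 3 = 1 := by
  rw [← pow_mul, mul_comm, pow_mul, hω.pow_eq_one, one_pow]

lemma triple_mul {s x : F} (h : s ^ 3 = 1) : s * (s * (s * x)) = x := by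
  linear_combination x * h

lemma phi3_cube {ω : F} (hω : IsPrimitiveRoot ω 3) (u : Mbig F) :
    phi3 F ω (phi3 F ω (phi3 F ω u)) = u := by
  refine mbig_ext ?_ ?_ ?_ ?_ ?_ <;> intros <;>
    simp only [phi3_eq hω, dgM, dgT, dgS, Matrix.of_apply] <;> apply triple_mul <;>
    simp only [mul_pow, pow3 hω, one_mul]

lemma phi12 (ω : F) (u : Mbig F) : phi1 F ω (phi2 F u) = phi2 F (phi1 F ω u) := by
  simp only [phi1_eq, phi2_eq]; rfl

lemma phi13 {ω : F} (hω : IsPrimitiveRoot ω 3) (u : Mbig F) :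
    phi1 F ω (phi3 F ω u) = phi3 F ω (phi1 F ω u) := by
  refine mbig_ext ?_ ?_ ?_ ?_ ?_ <;> intros <;>
    simp only [phi3_eq hω, phi1_eq, dgT, dgS, Pi.smul_apply, smul_eq_mul] <;> ring

lemma w_mod {ω : F} (hω : IsPrimitiveRoot ω 3) {m n : ℕ} (h : m % 3 = n % 3) :
    ω ^ m = ω ^ n := by
  rw [pow_eq_pow_mod _ hω.pow_eq_one, h, ← pow_eq_pow_mod _ hω.pow_eq_one]

lemma sM (i j : Fin 3) :
    ((i - 1).val + 2 * (j - 1).val) % 3 = (i.val + 2 * j.val) % 3 := by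
  revert i j; decide
lemma sT (i j k : Fin 3) :
    ((i - 1).val + (j - 1).val + (k - 1).val) % 3 = (i.val + j.val + k.val) % 3 := by
  revert i j k; decide
lemma sS (i j k : Fin 3) :
    (2 * ((i - 1).val + (j - 1).val + (k - 1).val)) % 3
      = (2 * (i.val + j.val + k.val)) % 3 := by
  revert i j k; decide

lemma phi23 {ω : F} (hω : IsPrimitiveRoot ω 3) (u : Mbig F) :
    phi2 F (phi3 F ω u) = phi3 F ω (phi2 F u) := by
  refine mbig_ext ?_ ?_ ?_ ?_ ?_ <;> intros <;>
    simp only [phi3_eq hω, phi2_eq, dgM, shM, shT, dgT, dgS, Matrix.of_apply, ← pow_add,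
      w_mod hω (sM _ _), w_mod hω (sT _ _ _), w_mod hω (sS _ _ _)]

lemma mem_Lcomp (ω : F) (g : ZMod 3 × ZMod 3 × ZMod 3) (u : Lsub F) :
    u ∈ Lcomp F ω g ↔ phi1 F ω u = wpow F ω g.1 • (u : Mbig F) ∧
      phi2 F u = wpow F ω g.2.1 • (u : Mbig F) ∧ phi3 F ω u = wpow F ω g.2.2 • (u : Mbig F) := by
  simp only [Lcomp, eigAmb, Submodule.mem_comap, Submodule.mem_inf, LinearMap.mem_ker,
    LinearMap.sub_apply, LinearMap.smul_apply, LinearMap.id_apply, sub_eq_zero,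
    Submodule.subtype_apply, and_assoc]

lemma Lcomp_internal {ω : F} (hω : IsPrimitiveRoot ω 3) :
    DirectSum.IsInternal (Lcomp F ω) := by
  refine isInternal_three hω ((phi1 F ω).restrict (phi1_mem ω))
    ((phi2 F).restrict phi2_mem) ((phi3 F ω).restrict (phi3_mem hω)) ?_ ?_ ?_ ?_ ?_ ?_ _ ?_
  · exact fun x => Subtype.ext (phi1_cube hω x)
  · exact fun x => Subtype.ext (phi2_cube _)
  · exact fun x => Subtype.ext (phi3_cube hω x)
  · exact fun x => Subtype.ext (phi12 ω x)
  · exact fun x => Subtype.ext (phi13 hω x)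
  · exact fun x => Subtype.ext (phi23 hω x)
  · intro g x
    rw [mem_Lcomp]
    simp only [Subtype.ext_iff]
    rfl

lemma Lcomp_bracket {ω : F} (hω : IsPrimitiveRoot ω 3) (g h : ZMod 3 × ZMod 3 × ZMod 3)
    (u : Lsub F) (hu : u ∈ Lcomp F ω g) (v : Lsub F) (hv : v ∈ Lcomp F ω h) :
    Bsub F u v ∈ Lcomp F ω (g + h) := by
  rw [mem_Lcomp] at *
  obtain ⟨a1, a2, a3⟩ := hu
  obtain ⟨b1, b2, b3⟩ := hv
  simp only [Bsub, Prod.fst_add, Prod.snd_add, wpow_add hω]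
  refine ⟨?_, ?_, ?_⟩
  · rw [phi1_B hω, a1, b1, B_smul]
  · rw [phi2_B, a2, b2, B_smul]
  · rw [phi3_B hω, a3, b3, B_smul]

lemma mat_zero {ω : F} (hω : IsPrimitiveRoot ω 3) (m : gl3 F) (s : F) (c : Fin 3)
    (hs : ∀ i j, m (i - 1) (j - 1) = s * m i j)
    (hd : ∀ i j, ω ^ i.val * ω ^ (2 * j.val) * m i j = ω ^ c.val * m i j)
    (h0 : m 0 (-c) = 0) : m = 0 := by
  have st : ∀ i j, m i j = 0 → m (i - 1) (j - 1) = 0 := fun i j h => by rw [hs, h, mul_zero]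
  ext i j
  rw [Matrix.zero_apply]
  by_cases h : (i.val + 2 * j.val) % 3 = c.val
  · have key : (i = 0 ∧ j = -c) ∨ (i = 0 - 1 ∧ j = -c - 1) ∨
        (i = 0 - 1 - 1 ∧ j = -c - 1 - 1) := by
      clear hs hd h0 st; revert i j c; decide
    rcases key with ⟨rfl, rfl⟩ | ⟨rfl, rfl⟩ | ⟨rfl, rfl⟩
    · exact h0
    · exact st _ _ h0
    · exact st _ _ (st _ _ h0)
  · by_contra hm
    have := mul_right_cancel₀ hm (hd i j)
    rw [← pow_add, pow_eq_pow_mod _ hω.pow_eq_one] at this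
    exact h (hω.pow_inj (Nat.mod_lt _ (by norm_num)) c.isLt this)

lemma ten_zero {ω : F} (hω : IsPrimitiveRoot ω 3) (x : T3 F) (s : F) (c : Fin 3)
    (hs : ∀ i j k, x (i - 1) (j - 1) (k - 1) = s * x i j k)
    (hd : ∀ i j k, ω ^ (i.val + j.val + k.val) * x i j k = ω ^ c.val * x i j k)
    (h0 : ∀ j, x 0 j (c - j) = 0) : x = 0 := by
  have st : ∀ i j k, x i j k = 0 → x (i - 1) (j - 1) (k - 1) = 0 :=
    fun i j k h => by rw [hs, h, mul_zero]
  funext i j k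
  show x i j k = 0
  by_cases h : (i.val + j.val + k.val) % 3 = c.val
  · have key : (i = 0 ∧ k = c - j) ∨
        (i = 0 - 1 ∧ j = (j + 1) - 1 ∧ k = c - (j + 1) - 1) ∨
        (i = 0 - 1 - 1 ∧ j = (j + 2) - 1 - 1 ∧ k = c - (j + 2) - 1 - 1) := by
      clear hs hd h0 st; revert i j k c; decide
    rcases key with ⟨rfl, rfl⟩ | ⟨rfl, hj, rfl⟩ | ⟨rfl, hj, rfl⟩
    · exact h0 j
    · have := st _ _ _ (h0 (j + 1))
      rwa [← hj] at this
    · have := st _ _ _ (st _ _ _ (h0 (j + 2)))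
      rwa [← hj] at this
  · by_contra hm
    have := mul_right_cancel₀ hm (hd i j k)
    rw [pow_eq_pow_mod _ hω.pow_eq_one] at this
    exact h (hω.pow_inj (Nat.mod_lt _ (by norm_num)) c.isLt this)

/-- The equations satisfied by the coordinates of a homogeneous element. -/
lemma Lcomp_eqs {ω : F} (hω : IsPrimitiveRoot ω 3) (a b c : Fin 3) (u : Lsub F)
    (hu : u ∈ Lcomp F ω (a, b, c)) :
    (u.1.1 = ω ^ a.val • u.1.1 ∧ ω • u.1.2.1 = ω ^ a.val • u.1.2.1 ∧
      ω ^ 2 • u.1.2.2 = ω ^ a.val • u.1.2.2) ∧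
    ((∀ i j, u.1.1.1 (i - 1) (j - 1) = ω ^ b.val * u.1.1.1 i j) ∧
      (∀ i j, u.1.1.2.1 (i - 1) (j - 1) = ω ^ b.val * u.1.1.2.1 i j) ∧
      (∀ i j, u.1.1.2.2 (i - 1) (j - 1) = ω ^ b.val * u.1.1.2.2 i j) ∧
      (∀ i j k, u.1.2.1 (i - 1) (j - 1) (k - 1) = ω ^ b.val * u.1.2.1 i j k) ∧
      (∀ i j k, u.1.2.2 (i - 1) (j - 1) (k - 1) = ω ^ b.val * u.1.2.2 i j k)) ∧
    ((∀ i j : Fin 3, ω ^ i.val * ω ^ (2 * j.val) * u.1.1.1 i j = ω ^ c.val * u.1.1.1 i j) ∧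
      (∀ i j : Fin 3, ω ^ i.val * ω ^ (2 * j.val) * u.1.1.2.1 i j = ω ^ c.val * u.1.1.2.1 i j) ∧
      (∀ i j : Fin 3, ω ^ i.val * ω ^ (2 * j.val) * u.1.1.2.2 i j = ω ^ c.val * u.1.1.2.2 i j) ∧
      (∀ i j k : Fin 3, ω ^ (i.val + j.val + k.val) * u.1.2.1 i j k
        = ω ^ c.val * u.1.2.1 i j k) ∧
      (∀ i j k : Fin 3, ω ^ (2 * (i.val + j.val + k.val)) * u.1.2.2 i j k
        = ω ^ c.val * u.1.2.2 i j k)) := by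
  rw [mem_Lcomp, phi1_eq, phi2_eq, phi3_eq hω] at hu
  obtain ⟨h1, h2, h3⟩ := hu
  refine ⟨⟨congrArg Prod.fst h1, congrArg (fun z => z.2.1) h1, congrArg (fun z => z.2.2) h1⟩,
    ⟨fun i j => congrArg (fun z : Mbig F => z.1.1 i j) h2,
      fun i j => congrArg (fun z : Mbig F => z.1.2.1 i j) h2,
      fun i j => congrArg (fun z : Mbig F => z.1.2.2 i j) h2,
      fun i j k => congrArg (fun z : Mbig F => z.2.1 i j k) h2,
      fun i j k => congrArg (fun z : Mbig F => z.2.2 i j k) h2⟩,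
    ⟨fun i j => congrArg (fun z : Mbig F => z.1.1 i j) h3,
      fun i j => congrArg (fun z : Mbig F => z.1.2.1 i j) h3,
      fun i j => congrArg (fun z : Mbig F => z.1.2.2 i j) h3,
      fun i j k => congrArg (fun z : Mbig F => z.2.1 i j k) h3,
      fun i j k => congrArg (fun z : Mbig F => z.2.2 i j k) h3⟩⟩

lemma smul_zero_of {M : Type*} [AddCommGroup M] [Module F M] {ω : F}
    (hω : IsPrimitiveRoot ω 3) {m n : ℕ} (hm : m < 3) (hn : n < 3) (hmn : m ≠ n) {x : M}
    (h : ω ^ m • x = ω ^ n • x) : x = 0 := by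
  have h' : (ω ^ m - ω ^ n) • x = 0 := by rw [sub_smul, h, sub_self]
  rcases smul_eq_zero.mp h' with h0 | h0
  · exact absurd (hω.pow_inj hm hn (sub_eq_zero.mp h0)) hmn
  · exact h0

/-- Which of the three layers vanish. -/
lemma Lcomp_layers {ω : F} (hω : IsPrimitiveRoot ω 3) (a b c : Fin 3) (u : Lsub F)
    (hu : u ∈ Lcomp F ω (a, b, c)) :
    (a.val ≠ 0 → u.1.1 = 0) ∧ (a.val ≠ 1 → u.1.2.1 = 0) ∧ (a.val ≠ 2 → u.1.2.2 = 0) := by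
  obtain ⟨⟨h1, h2, h3⟩, -⟩ := Lcomp_eqs hω a b c u hu
  refine ⟨fun h => ?_, fun h => ?_, fun h => ?_⟩
  · exact smul_zero_of hω (m := 0) (by norm_num) a.isLt h.symm (by rw [pow_zero, one_smul]; exact h1)
  · exact smul_zero_of hω (m := 1) (by norm_num) a.isLt h.symm (by rw [pow_one]; exact h2)
  · exact smul_zero_of hω (m := 2) (by norm_num) a.isLt h.symm h3

/-- coordinates of a component of degree `(0,b,c)` -/
def ev0 (c : Fin 3) : Mbig F →ₗ[F] (Fin 3 → F) where
  toFun u := ![u.1.1 0 (-c), u.1.2.1 0 (-c), u.1.2.2 0 (-c)]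
  map_add' u v := by ext i; fin_cases i <;> rfl
  map_smul' u v := by ext i; fin_cases i <;> rfl

/-- coordinates of a component of degree `(1,b,c)` -/
def ev1 (c : Fin 3) : Mbig F →ₗ[F] (Fin 3 → F) where
  toFun u := fun j => u.2.1 0 j (c - j)
  map_add' u v := rfl
  map_smul' u v := rfl

/-- coordinates of a component of degree `(2,b,-c)` -/
def ev2 (c : Fin 3) : Mbig F →ₗ[F] (Fin 3 → F) where
  toFun u := fun j => u.2.2 0 j (c - j)
  map_add' u v := rfl
  map_smul' u v := rfl

lemma finrank_le_of_ev (S : Submodule F (Lsub F)) (e : Mbig F →ₗ[F] (Fin 3 → F))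
    (h : ∀ u ∈ S, e u = 0 → u = 0) : Module.finrank F S ≤ 3 := by
  have hi : Function.Injective (e ∘ₗ (Lsub F).subtype ∘ₗ S.subtype) := by
    rw [injective_iff_map_eq_zero]
    intro u hu
    exact Subtype.ext (h u u.2 hu)
  simpa using LinearMap.finrank_le_finrank_of_injective hi

lemma Lcomp_zero_aux {ω : F} (hω : IsPrimitiveRoot ω 3) (b c : Fin 3) (u : Lsub F)
    (hu : u ∈ Lcomp F ω (0, b, c)) (h1 : u.1.1.1 0 (-c) = 0) (h2 : u.1.1.2.1 0 (-c) = 0)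
    (h3 : u.1.1.2.2 0 (-c) = 0) : u = 0 := by
  obtain ⟨-, k1, k2⟩ := Lcomp_layers hω 0 b c u hu
  obtain ⟨-, ⟨s1, s2, s3, -⟩, ⟨d1, d2, d3, -⟩⟩ := Lcomp_eqs hω 0 b c u hu
  exact Subtype.ext (Prod.ext (Prod.ext (mat_zero hω _ _ c s1 d1 h1)
    (Prod.ext (mat_zero hω _ _ c s2 d2 h2) (mat_zero hω _ _ c s3 d3 h3)))
    (Prod.ext (k1 (by simp)) (k2 (by simp))))

lemma Lcomp_le {ω : F} (hω : IsPrimitiveRoot ω 3) (g : ZMod 3 × ZMod 3 × ZMod 3) :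
    Module.finrank F (Lcomp F ω g) ≤ 3 := by
  obtain ⟨a, b, c⟩ := g
  change Fin 3 at a b c
  have ha : a = 0 ∨ a = 1 ∨ a = 2 := by revert a; decide
  rcases ha with rfl | rfl | rfl
  · refine finrank_le_of_ev _ (ev0 c) fun u hu he => ?_
    exact Lcomp_zero_aux hω b c u hu (congrFun he 0) (congrFun he 1) (congrFun he 2)
  · refine finrank_le_of_ev _ (ev1 c) fun u hu he => ?_
    obtain ⟨k0, -, k2⟩ := Lcomp_layers hω 1 b c u hu
    obtain ⟨-, ⟨-, -, -, s, -⟩, ⟨-, -, -, d, -⟩⟩ := Lcomp_eqs hω 1 b c u hu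
    exact Subtype.ext (Prod.ext (k0 (by simp))
      (Prod.ext (ten_zero hω _ _ c s d (congrFun he)) (k2 (by simp))))
  · refine finrank_le_of_ev _ (ev2 (-c)) fun u hu he => ?_
    obtain ⟨k0, k1, -⟩ := Lcomp_layers hω 2 b c u hu
    obtain ⟨-, ⟨-, -, -, -, s⟩, ⟨-, -, -, -, d⟩⟩ := Lcomp_eqs hω 2 b c u hu
    refine Subtype.ext (Prod.ext (k0 (by simp))
      (Prod.ext (k1 (by simp)) (ten_zero hω _ _ (-c) s ?_ (congrFun he))))
    intro i j k
    have ec : ∀ c : Fin 3, (c.val + (-c).val) % 3 = 0 % 3 := by decide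
    have e3 : ω ^ c.val * ω ^ (-c).val = 1 := by
      rw [← pow_add, w_mod hω (n := 0) (ec c), pow_zero]
    have e4 := w_unit hω (i.val + j.val + k.val)
    have := d i j k
    linear_combination (-(ω ^ (i.val + j.val + k.val) * ω ^ (-c).val)) * this
      - (ω ^ (i.val + j.val + k.val) * u.1.2.2 i j k) * e3
      + (ω ^ (-c).val * u.1.2.2 i j k) * e4

lemma trace_const_zero (m : gl3 F) (hs : ∀ i j, m (i - 1) (j - 1) = m i j)
    (ht : Matrix.trace m = 0) : m 0 0 = 0 := by
  rw [Matrix.trace_fin_three] at ht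
  have h1 : m 0 0 = m 1 1 := hs 1 1
  have h2 : m 1 1 = m 2 2 := hs 2 2
  have : (3 : F) * m 0 0 = 0 := by linear_combination ht + 2 * h1 + h2
  exact (mul_eq_zero.mp this).resolve_left (by norm_num)

lemma Lcomp_zero {ω : F} (hω : IsPrimitiveRoot ω 3) : Lcomp F ω (0, 0, 0) = ⊥ := by
  rw [eq_bot_iff]
  intro u hu
  obtain ⟨t1, t2, t3⟩ := (mem_Lsub _).mp u.2
  obtain ⟨-, ⟨s1, s2, s3, -⟩, -⟩ := Lcomp_eqs hω 0 0 0 u hu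
  simp only [Fin.val_zero, pow_zero, one_mul] at s1 s2 s3
  exact Lcomp_zero_aux hω 0 0 u hu (trace_const_zero _ s1 t1) (trace_const_zero _ s2 t2)
    (trace_const_zero _ s3 t3)

/-- the three traces -/
def traces : Mbig F →ₗ[F] (Fin 3 → F) where
  toFun u := ![Matrix.trace u.1.1, Matrix.trace u.1.2.1, Matrix.trace u.1.2.2]
  map_add' u v := by ext i; fin_cases i <;> simp
  map_smul' u v := by ext i; fin_cases i <;> simp

lemma finrank_Lsub : 78 ≤ Module.finrank F (Lsub F) := by
  have h1 : Lsub F = LinearMap.ker (traces : Mbig F →ₗ[F] _) := by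
    ext u
    rw [mem_Lsub, LinearMap.mem_ker]
    constructor
    · rintro ⟨h1, h2, h3⟩
      funext i; fin_cases i
      exacts [h1, h2, h3]
    · intro h
      exact ⟨congrFun h 0, congrFun h 1, congrFun h 2⟩
  have h2 := LinearMap.finrank_range_add_finrank_ker (traces : Mbig F →ₗ[F] _)
  have h3 : Module.finrank F (Mbig F) = 81 := by
    simp [Module.finrank_prod, Module.finrank_matrix, Module.finrank_pi_fintype]
  have h4 : Module.finrank F (LinearMap.range (traces : Mbig F →ₗ[F] _)) ≤ 3 := by
    simpa using Submodule.finrank_le (LinearMap.range (traces : Mbig F →ₗ[F] _))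
  rw [h1]
  omega

lemma Lcomp_finrank {ω : F} (hω : IsPrimitiveRoot ω 3) (g : ZMod 3 × ZMod 3 × ZMod 3)
    (hg : g ≠ (0, 0, 0)) : Module.finrank F (Lcomp F ω g) = 3 := by
  have e : Module.finrank F (Lsub F) = ∑ g, Module.finrank F (Lcomp F ω g) :=
    finrank_of_internal _ (Lcomp_internal hω)
  by_contra hne
  have hlt : Module.finrank F (Lcomp F ω g) < 3 := lt_of_le_of_ne (Lcomp_le hω g) hne
  have hs : ∑ g, Module.finrank F (Lcomp F ω g) <
      ∑ g : ZMod 3 × ZMod 3 × ZMod 3, if g = (0, 0, 0) then 0 else 3 := by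
    refine Finset.sum_lt_sum (fun i _ => ?_) ⟨g, Finset.mem_univ _, by rwa [if_neg hg]⟩
    split_ifs with hi
    · rw [hi, Lcomp_zero hω, finrank_bot]
    · exact Lcomp_le hω i
  have h78 : (∑ g : ZMod 3 × ZMod 3 × ZMod 3, if g = (0, 0, 0) then 0 else 3) = 78 := by decide
  have := finrank_Lsub (F := F)
  omega

end concretePart

/-- `φ₁, φ₂, φ₃` are pairwise commuting Lie algebra automorphisms of `L` of
order exactly 3, and their joint eigenspace decomposition is a `ℤ₃³`-grading of `L` with
zero component `0` and all other components of dimension 3. -/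
theorem e6_Z3_cubed_grading (ω : F) (hω : IsPrimitiveRoot ω 3) :
    -- each φᵢ preserves L and its bracket (is an automorphism of L)
    ((∀ u ∈ Lsub F, phi1 F ω u ∈ Lsub F) ∧ (∀ u ∈ Lsub F, phi2 F u ∈ Lsub F) ∧
      (∀ u ∈ Lsub F, phi3 F ω u ∈ Lsub F)) ∧
    ((∀ u v : ↥(Lsub F), phi1 F ω (B F ↑u ↑v) = B F (phi1 F ω ↑u) (phi1 F ω ↑v)) ∧
      (∀ u v : ↥(Lsub F), phi2 F (B F ↑u ↑v) = B F (phi2 F ↑u) (phi2 F ↑v)) ∧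
      (∀ u v : ↥(Lsub F), phi3 F ω (B F ↑u ↑v) = B F (phi3 F ω ↑u) (phi3 F ω ↑v))) ∧
    -- pairwise commuting
    ((∀ u : ↥(Lsub F), phi1 F ω (phi2 F ↑u) = phi2 F (phi1 F ω ↑u)) ∧
      (∀ u : ↥(Lsub F), phi1 F ω (phi3 F ω ↑u) = phi3 F ω (phi1 F ω ↑u)) ∧
      (∀ u : ↥(Lsub F), phi2 F (phi3 F ω ↑u) = phi3 F ω (phi2 F ↑u))) ∧
    -- of order exactly 3
    ((∀ u : ↥(Lsub F), phi1 F ω (phi1 F ω (phi1 F ω ↑u)) = ↑u) ∧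
      (∀ u : ↥(Lsub F), phi2 F (phi2 F (phi2 F ↑u)) = ↑u) ∧
      (∀ u : ↥(Lsub F), phi3 F ω (phi3 F ω (phi3 F ω ↑u)) = ↑u) ∧
      (∃ u : ↥(Lsub F), phi1 F ω ↑u ≠ ↑u) ∧ (∃ u : ↥(Lsub F), phi2 F ↑u ≠ ↑u) ∧
      (∃ u : ↥(Lsub F), phi3 F ω ↑u ≠ ↑u)) ∧
    -- the simultaneous eigenspace decomposition is a ℤ₃³-grading of L ...
    (DirectSum.IsInternal (Lcomp F ω) ∧
      (∀ g h : ZMod 3 × ZMod 3 × ZMod 3, ∀ u ∈ Lcomp F ω g, ∀ v ∈ Lcomp F ω h,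
        Bsub F u v ∈ Lcomp F ω (g + h))) ∧
    -- ... with L_{(0,0,0)} = 0 and every other component of dimension 3
    (Lcomp F ω (0, 0, 0) = ⊥ ∧
      ∀ g : ZMod 3 × ZMod 3 × ZMod 3, g ≠ (0, 0, 0) →
        Module.finrank F ↥(Lcomp F ω g) = 3) := by
  refine ⟨⟨fun u h => phi1_mem ω u h, fun u h => phi2_mem u h, fun u h => phi3_mem hω u h⟩,
    ⟨fun u v => phi1_B hω u v, fun u v => phi2_B _ _, fun u v => phi3_B hω u v⟩,
    ⟨fun u => phi12 ω u, fun u => phi13 hω u, fun u => phi23 hω u⟩,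
    ⟨fun u => phi1_cube hω u, fun u => phi2_cube _, fun u => phi3_cube hω u, ?_, ?_, ?_⟩,
    ⟨Lcomp_internal hω, fun g h u hu v hv => Lcomp_bracket hω g h u hu v hv⟩,
    Lcomp_zero hω, fun g hg => Lcomp_finrank hω g hg⟩
  · refine ⟨⟨(0, (fun _ _ _ => 1, 0)), (mem_Lsub _).mpr (by simp)⟩, fun h => ?_⟩
    have h' := congrArg (fun z : Mbig F => z.2.1 0 0 0) h
    simp [phi1_eq] at h'
    exact hω.ne_one (by norm_num) h'
  · refine ⟨⟨(0, (fun i _ _ => if i = 0 then 1 else 0, 0)), (mem_Lsub _).mpr (by simp)⟩,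
      fun h => ?_⟩
    have h' := congrArg (fun z : Mbig F => z.2.1 1 0 0) h
    simp [phi2_eq, shT] at h'
  · refine ⟨⟨(0, (fun _ _ _ => 1, 0)), (mem_Lsub _).mpr (by simp)⟩, fun h => ?_⟩
    have h' := congrArg (fun z : Mbig F => z.2.1 1 0 0) h
    simp [phi3_eq hω, dgT] at h'
    exact hω.ne_one (by norm_num) h'

end
end

section
/- Take X₂ = X₃ (the same 3-dimensional space with the same trilinear form) and let τ: L → L be the linear map which is the identity on sl(X₁), swaps the summands sl(X₂) and sl(X₃) of L₀, sends x⊗v⊗w ↦ x⊗w⊗v on L₁, and f⊗g⊗h ↦ f⊗h⊗g on L₂. Then τ is a Lie algebra automorphism of L of order 2, its fixed subalgebra L^τ := {x ∈ L : τ(x) = x} has dimension 52, and L^τ is a simple Lie algebra (a model of the exceptional simple Lie algebra f₄). -/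
noncomputable section

open Matrix
open scoped BigOperators

variable (F : Type*) [Field F] [IsAlgClosed F] [CharZero F]

set_option linter.unusedSectionVars false

/-- The order-2 automorphism `τ` of `L` (taking `X₂ = X₃`): identity on `sl(X₁)`, swapping
`sl(X₂)` and `sl(X₃)`, and exchanging the last two tensor factors on `L₁` and `L₂`. -/
def tau : Mbig F →ₗ[F] Mbig F where
  toFun u := ((u.1.1, u.1.2.2, u.1.2.1),
              ((fun i j k => u.2.1 i k j), (fun i j k => u.2.2 i k j)))
  map_add' u v := by ext <;> simp
  map_smul' c u := by ext <;> simp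

/-- The fixed subalgebra `L^τ = {x ∈ L : τ(x) = x}`, a model of `f₄`. -/
def Ltau : Submodule F ↥(Lsub F) :=
  Submodule.comap (Lsub F).subtype (LinearMap.ker (tau F - LinearMap.id))

/-! ### Helper lemmas -/

/-- A `τ`-symmetric element of the ambient space. -/
def elt (a b : gl3 F) (x f : T3 F) : Mbig F := ((a, b, b), (x, f))

lemma elt_mem {a b : gl3 F} {x f : T3 F} (ha : trace a = 0) (hb : trace b = 0) :
    elt F a b x f ∈ Lsub F :=
  ⟨⟨ha, hb, hb⟩, trivial, trivial⟩

lemma elt_tau {a b : gl3 F} {x f : T3 F} (hx : ∀ i j k, x i j k = x i k j)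
    (hf : ∀ i j k, f i j k = f i k j) : tau F (elt F a b x f) = elt F a b x f := by
  have h1 : (fun i j k => x i k j) = x := by funext i j k; exact (hx i j k).symm
  have h2 : (fun i j k => f i k j) = f := by funext i j k; exact (hf i j k).symm
  show ((a, b, b), ((fun i j k => x i k j), (fun i j k => f i k j))) = ((a, b, b), (x, f))
  rw [h1, h2]

lemma fixed_form {v : Mbig F} (h : tau F v = v) :
    v.1.2.1 = v.1.2.2 ∧ (∀ i j k, v.2.1 i j k = v.2.1 i k j) ∧
      (∀ i j k, v.2.2 i j k = v.2.2 i k j) := by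
  have h' : ((v.1.1, v.1.2.2, v.1.2.1),
      ((fun i j k => v.2.1 i k j), (fun i j k => v.2.2 i k j))) = v := h
  refine ⟨?_, fun i j k => ?_, fun i j k => ?_⟩
  · exact (congrArg (fun w : Mbig F => w.1.2.1) h').symm
  · exact (congrArg (fun w : Mbig F => w.2.1 i j k) h').symm
  · exact (congrArg (fun w : Mbig F => w.2.2 i j k) h').symm

lemma wedge_swap (x y : T3 F) (c d e : Fin 3) :
    wedgeT F (fun i j k => x i k j) (fun i j k => y i k j) c d e = wedgeT F x y c e d := by
  unfold wedgeT
  refine Finset.sum_congr rfl fun i _ => ?_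
  rw [Finset.sum_comm]
  refine Finset.sum_congr rfl fun j _ => Finset.sum_congr rfl fun k _ =>
    Finset.sum_congr rfl fun l _ => ?_
  rw [Finset.sum_comm]
  refine Finset.sum_congr rfl fun m _ => Finset.sum_congr rfl fun n _ => ?_
  ring

lemma tpair_swap (f x : T3 F) :
    tpair F (fun i j k => f i k j) (fun i j k => x i k j) = tpair F f x := by
  unfold tpair
  exact Finset.sum_congr rfl fun i _ => Finset.sum_comm

lemma pair1_swap (f x : T3 F) :
    pair1 F (fun i j k => f i k j) (fun i j k => x i k j) = pair1 F f x := by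
  unfold pair1
  rw [tpair_swap]
  ext r s
  simp only [Matrix.of_apply]
  rw [Finset.sum_comm]

lemma pair2_swap (f x : T3 F) :
    pair2 F (fun i j k => f i k j) (fun i j k => x i k j) = pair3 F f x := by
  unfold pair2 pair3
  rw [tpair_swap]

lemma pair3_swap (f x : T3 F) :
    pair3 F (fun i j k => f i k j) (fun i j k => x i k j) = pair2 F f x := by
  unfold pair2 pair3
  rw [tpair_swap]

lemma tau_B (u v : Mbig F) : tau F (B F u v) = B F (tau F u) (tau F v) := by
  refine Prod.ext (Prod.ext ?_ (Prod.ext ?_ ?_)) (Prod.ext ?_ ?_)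
  · show _ = _ + pair1 F (fun i j k => u.2.2 i k j) (fun i j k => v.2.1 i k j)
      - pair1 F (fun i j k => v.2.2 i k j) (fun i j k => u.2.1 i k j)
    rw [pair1_swap F u.2.2 v.2.1, pair1_swap F v.2.2 u.2.1]; rfl
  · show _ = _ + pair2 F (fun i j k => u.2.2 i k j) (fun i j k => v.2.1 i k j)
      - pair2 F (fun i j k => v.2.2 i k j) (fun i j k => u.2.1 i k j)
    rw [pair2_swap, pair2_swap]; rfl
  · show _ = _ + pair3 F (fun i j k => u.2.2 i k j) (fun i j k => v.2.1 i k j)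
      - pair3 F (fun i j k => v.2.2 i k j) (fun i j k => u.2.1 i k j)
    rw [pair3_swap, pair3_swap]; rfl
  · funext c d e
    have := wedge_swap F u.2.2 v.2.2 c d e
    simp only [tau, B, LinearMap.coe_mk, AddHom.coe_mk, Pi.add_apply, Pi.sub_apply, this, actT]
    ring
  · funext c d e
    have := wedge_swap F u.2.1 v.2.1 c d e
    simp only [tau, B, LinearMap.coe_mk, AddHom.coe_mk, Pi.add_apply, Pi.sub_apply, this, coactT]
    ring

/-! ### Vanishing lemmas -/

lemma tpair_zl (x : T3 F) : tpair F 0 x = 0 := by simp [tpair]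
lemma tpair_zr (x : T3 F) : tpair F x 0 = 0 := by simp [tpair]
lemma pair1_zl (x : T3 F) : pair1 F 0 x = 0 := by ext; simp [pair1, tpair_zl]
lemma pair1_zr (x : T3 F) : pair1 F x 0 = 0 := by ext; simp [pair1, tpair_zr]
lemma pair2_zl (x : T3 F) : pair2 F 0 x = 0 := by ext; simp [pair2, tpair_zl]
lemma pair2_zr (x : T3 F) : pair2 F x 0 = 0 := by ext; simp [pair2, tpair_zr]
lemma pair3_zl (x : T3 F) : pair3 F 0 x = 0 := by ext; simp [pair3, tpair_zl]
lemma pair3_zr (x : T3 F) : pair3 F x 0 = 0 := by ext; simp [pair3, tpair_zr]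
lemma wedge_zl (x : T3 F) : wedgeT F 0 x = 0 := by funext c d e; simp [wedgeT]
lemma wedge_zr (x : T3 F) : wedgeT F x 0 = 0 := by funext c d e; simp [wedgeT]
lemma act_zr (g : gl3 F × gl3 F × gl3 F) : actT F g 0 = 0 := by funext c d e; simp [actT]
lemma coact_zr (g : gl3 F × gl3 F × gl3 F) : coactT F g 0 = 0 := by funext c d e; simp [coactT]
lemma act_zl (x : T3 F) : actT F (0, 0, 0) x = 0 := by funext c d e; simp [actT]
lemma coact_zl (x : T3 F) : coactT F (0, 0, 0) x = 0 := by funext c d e; simp [coactT]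

/-- Action on the first factor. -/
def act1 (c : gl3 F) (x : T3 F) : T3 F := fun i j k => ∑ a, c i a * x a j k

/-- Dual action on the first factor. -/
def coact1 (c : gl3 F) (x : T3 F) : T3 F := fun i j k => -∑ a, c a i * x a j k

lemma act1_act1 (c : gl3 F) (h : c * c = 0) (x : T3 F) : act1 F c (act1 F c x) = 0 := by
  funext i j k
  have : ∀ i b, ∑ a, c i a * c a b = 0 := fun i b => by
    have := congrFun (congrFun h i) b
    simpa [Matrix.mul_apply] using this
  simp only [act1, Finset.mul_sum]
  rw [Finset.sum_comm]
  simp only [← mul_assoc, ← Finset.sum_mul, this]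
  simp

lemma coact1_coact1 (c : gl3 F) (h : c * c = 0) (x : T3 F) : coact1 F c (coact1 F c x) = 0 := by
  funext i j k
  have : ∀ i b, ∑ a, c a i * c b a = 0 := fun i b => by
    have := congrFun (congrFun h b) i
    simp only [Matrix.mul_apply] at this
    simpa [mul_comm] using this
  simp only [coact1, Finset.mul_sum, mul_neg, Finset.sum_neg_distrib, neg_neg]
  rw [Finset.sum_comm]
  simp only [← mul_assoc, ← Finset.sum_mul, this]
  simp

/-- Bracket with an element of `sl(X₁)`. -/
lemma B_left1 (c : gl3 F) (v : Mbig F) :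
    B F (elt F c 0 0 0) v =
      ((c * v.1.1 - v.1.1 * c, 0, 0), (act1 F c v.2.1, coact1 F c v.2.2)) := by
  unfold B elt
  simp only [pair1_zl, pair1_zr, pair2_zl, pair2_zr, pair3_zl, pair3_zr, wedge_zl, act_zr,
    coact_zr, add_zero, sub_zero, zero_mul, mul_zero]
  refine Prod.ext rfl (Prod.ext ?_ ?_)
  · funext i j k; simp [actT, act1]
  · funext i j k; simp [coactT, coact1]

lemma single_sq {i j : Fin 3} (h : i ≠ j) :
    (Matrix.single i j (1 : F)) * Matrix.single i j 1 = 0 := by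
  rw [Matrix.single_mul_single_of_ne]; exact h.symm

/-- The double bracket with a root vector of `sl(X₁)`. -/
lemma double_B {i j : Fin 3} (h : i ≠ j) (v : Mbig F) :
    B F (elt F (Matrix.single i j 1) 0 0 0) (B F (elt F (Matrix.single i j 1) 0 0 0) v)
      = (-2 * v.1.1 j i) • elt F (Matrix.single i j 1) 0 0 0 := by
  have hs := single_sq F h
  rw [B_left1, B_left1]
  simp only [act1_act1 F _ hs, coact1_coact1 F _ hs]
  have key : Matrix.single i j (1 : F) * v.1.1 * Matrix.single i j 1
      = v.1.1 j i • Matrix.single i j 1 := by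
    rw [Matrix.single_mul_mul_single]
    simp [Matrix.smul_single]
  have : Matrix.single i j (1 : F) * (Matrix.single i j 1 * v.1.1 - v.1.1 * Matrix.single i j 1)
      - (Matrix.single i j 1 * v.1.1 - v.1.1 * Matrix.single i j 1) * Matrix.single i j 1
      = (-2 * v.1.1 j i) • Matrix.single i j 1 := by
    rw [mul_sub, sub_mul, ← mul_assoc, hs, mul_assoc v.1.1, hs, ← mul_assoc, key]
    rw [mul_smul, neg_smul, two_smul]
    simp; abel
  rw [this]
  simp [elt]

/-! ### Ideals -/

section ideal

variable {F}
variable (J : Submodule F (Mbig F))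

/-- Closure under bracket with symmetric elements. -/
def IdealLike : Prop :=
  (∀ v ∈ J, v ∈ Lsub F ∧ tau F v = v) ∧
  ∀ (a b : gl3 F) (x f : T3 F), trace a = 0 → trace b = 0 →
    (∀ i j k, x i j k = x i k j) → (∀ i j k, f i j k = f i k j) →
    ∀ v ∈ J, B F (elt F a b x f) v ∈ J

variable {J}

lemma B1_mem (hJ : IdealLike J) {c : gl3 F} (hc : trace c = 0) {v : Mbig F} (hv : v ∈ J) :
    B F (elt F c 0 0 0) v ∈ J :=
  hJ.2 c 0 0 0 hc (by simp) (by simp) (by simp) v hv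

lemma tr_single {i j : Fin 3} (h : i ≠ j) : trace (Matrix.single i j (1 : F)) = 0 := by
  simp [Matrix.trace_single_eq_of_ne, h]

lemma offdiag (hJ : IdealLike J) {i j : Fin 3} (h : i ≠ j) {v : Mbig F} (hv : v ∈ J)
    (hne : v.1.1 j i ≠ 0) : elt F (Matrix.single i j 1) 0 0 0 ∈ J := by
  have h1 := B1_mem hJ (tr_single h) (B1_mem hJ (tr_single h) hv)
  rw [double_B F h] at h1
  exact (Submodule.smul_mem_iff _ (by simpa using hne)).1 h1

/-- If `v ∈ J` has nonzero `sl(X₁)`-component then `J` contains a root vector. -/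
lemma step_a (hJ : IdealLike J) {v : Mbig F} (hv : v ∈ J) (hne : v.1.1 ≠ 0) :
    ∃ i j : Fin 3, i ≠ j ∧ elt F (Matrix.single i j 1) 0 0 0 ∈ J := by
  by_contra hcon
  push Not at hcon
  have hoff : ∀ i j, i ≠ j → v.1.1 j i = 0 := by
    intro i j h
    by_contra hn
    exact hcon i j h (offdiag hJ h hv hn)
  have hd : ∀ i j, i ≠ j → v.1.1 i i = v.1.1 j j := by
    intro i j h
    by_contra hn
    have h1 := B1_mem hJ (tr_single h) hv
    refine hcon j i h.symm (offdiag hJ h.symm h1 ?_)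
    rw [B_left1]
    simp only [Matrix.sub_apply, Matrix.single_mul_apply_same, Matrix.mul_single_apply_same]
    simpa [sub_eq_zero] using fun h => hn h.symm
  apply hne
  have ht : trace v.1.1 = 0 := (hJ.1 v hv).1.1.1
  rw [Matrix.trace_fin_three, ← hd 0 1 (by decide), ← hd 0 2 (by decide)] at ht
  have h0 : v.1.1 0 0 = 0 := by
    have : (3 : F) * v.1.1 0 0 = 0 := by linear_combination ht
    simpa using this
  ext i j
  by_cases hij : i = j
  · subst hij
    by_cases h : i = 0
    · subst h; simpa using h0
    · rw [hd i 0 h]; simpa using h0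
  · simpa using hoff j i (Ne.symm hij)

/-- Symmetrised basis tensor. -/
def symT (i j k : Fin 3) : T3 F := fun a b c =>
  if a = i ∧ ((b = j ∧ c = k) ∨ (b = k ∧ c = j)) then 1 else 0

lemma symT_symm (i j k a b c : Fin 3) : (symT i j k : T3 F) a b c = symT i j k a c b := by
  unfold symT
  congr 1
  apply propext
  tauto

lemma pair1_symT_left (x : T3 F) (hx : ∀ i j k, x i j k = x i k j) (r s j k : Fin 3)
    (h : r ≠ s) : pair1 F (symT s j k) x r s = (if j = k then 1 else 2) * x r j k := by
  simp only [pair1, Matrix.of_apply, h, if_false, symT, true_and]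
  have h1 := hx r 0 1
  have h2 := hx r 0 2
  have h3 := hx r 1 2
  fin_cases j <;> fin_cases k <;>
    simp [Fin.sum_univ_three] <;> first | done | (simp only [h1, h2, h3]; ring)

lemma pair1_symT_right (f : T3 F) (hf : ∀ i j k, f i j k = f i k j) (r s j k : Fin 3)
    (h : r ≠ s) : pair1 F f (symT r j k) r s = (if j = k then 1 else 2) * f s j k := by
  rw [← pair1_symT_left f hf s r j k h.symm]
  simp only [pair1, Matrix.of_apply, h, h.symm, if_false]
  simp only [mul_comm]

lemma coef_ne (j k : Fin 3) : (if j = k then (1 : F) else 2) ≠ 0 := by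
  split <;> simp

lemma exists_ne3 (r : Fin 3) : ∃ s, r ≠ s := by
  revert r; decide

lemma step_x (hJ : IdealLike J) {v : Mbig F} (hv : v ∈ J) (hne : v.2.1 ≠ 0) :
    ∃ i j : Fin 3, i ≠ j ∧ elt F (Matrix.single i j 1) 0 0 0 ∈ J := by
  obtain ⟨r, j, k, hr⟩ : ∃ r j k, v.2.1 r j k ≠ 0 := by
    by_contra hc; push Not at hc
    exact hne (by funext r j k; exact hc r j k)
  obtain ⟨s, hs⟩ := exists_ne3 r
  have h1 := hJ.2 0 0 0 (symT s j k) (by simp) (by simp) (by simp)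
    (symT_symm s j k) v hv
  refine step_a hJ h1 fun h => ?_
  have h2 := congrFun (congrFun h r) s
  simp only [B, elt, pair1_zr, sub_zero, zero_mul, mul_zero, zero_add, Matrix.zero_apply] at h2
  rw [pair1_symT_left _ (fixed_form F (hJ.1 v hv).2).2.1 r s j k hs] at h2
  exact mul_ne_zero (coef_ne j k) hr h2

lemma step_f (hJ : IdealLike J) {v : Mbig F} (hv : v ∈ J) (hne : v.2.2 ≠ 0) :
    ∃ i j : Fin 3, i ≠ j ∧ elt F (Matrix.single i j 1) 0 0 0 ∈ J := by
  obtain ⟨s, j, k, hr⟩ : ∃ r j k, v.2.2 r j k ≠ 0 := by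
    by_contra hc; push Not at hc
    exact hne (by funext r j k; exact hc r j k)
  obtain ⟨r, hs⟩ := exists_ne3 s
  have h1 := hJ.2 0 0 (symT r j k) 0 (by simp) (by simp) (symT_symm r j k) (by simp) v hv
  refine step_a hJ h1 fun h => ?_
  have h2 := congrFun (congrFun h r) s
  simp only [B, elt, pair1_zl, zero_mul, mul_zero, add_zero, sub_self, zero_sub,
    Matrix.zero_apply, Matrix.neg_apply, neg_eq_zero] at h2
  rw [pair1_symT_right _ (fixed_form F (hJ.1 v hv).2).2.2 r s j k hs.symm] at h2
  exact mul_ne_zero (coef_ne j k) hr h2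

lemma step_b (hJ : IdealLike J) {v : Mbig F} (hv : v ∈ J) (hne : v ≠ 0) :
    ∃ i j : Fin 3, i ≠ j ∧ elt F (Matrix.single i j 1) 0 0 0 ∈ J := by
  by_cases ha : v.1.1 = 0
  swap
  · exact step_a hJ hv ha
  by_cases hx : v.2.1 = 0
  swap
  · exact step_x hJ hv hx
  by_cases hf : v.2.2 = 0
  swap
  · exact step_f hJ hv hf
  have hb : v.1.2.1 = v.1.2.2 := (fixed_form F (hJ.1 v hv).2).1
  have hb0 : v.1.2.1 ≠ 0 := by
    intro h
    apply hne
    refine Prod.ext (Prod.ext ha (Prod.ext h ?_)) (Prod.ext hx hf)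
    rw [← hb, h]; rfl
  obtain ⟨j, k, hjk⟩ : ∃ j k, v.1.2.1 j k ≠ 0 := by
    by_contra hc; push Not at hc
    exact hb0 (by ext r j; exact hc r j)
  have h1 := hJ.2 0 0 (symT 0 k k) 0 (by simp) (by simp) (symT_symm 0 k k) (by simp) v hv
  refine step_x hJ h1 fun h => ?_
  have h2 := congrFun (congrFun (congrFun h 0) j) k
  simp only [B, elt, hx, hf, wedge_zl, act_zr, zero_sub, add_zero, Pi.neg_apply, Pi.zero_apply,
    neg_eq_zero, actT, ha, ← hb] at h2
  by_cases hj : j = k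
  · subst hj
    simp [symT] at h2
    exact hjk (by simpa [← two_mul] using h2)
  · simp [symT, hj] at h2
    exact hjk h2

/-- One root vector of `sl(X₁)` gives all. -/
lemma all_roots (hJ : IdealLike J) {i j : Fin 3} (h : i ≠ j)
    (hm : elt F (Matrix.single i j 1) 0 0 0 ∈ J) (r s : Fin 3) (hrs : r ≠ s) :
    elt F (Matrix.single r s 1) 0 0 0 ∈ J := by
  have opp : ∀ i j : Fin 3, i ≠ j → elt F (Matrix.single i j 1) 0 0 0 ∈ J →
      elt F (Matrix.single j i 1) 0 0 0 ∈ J := by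
    intro i j h hm
    exact offdiag hJ h.symm hm (by simp [elt])
  have left : ∀ i j k : Fin 3, i ≠ j → k ≠ i → k ≠ j → elt F (Matrix.single i j 1) 0 0 0 ∈ J →
      elt F (Matrix.single k j 1) 0 0 0 ∈ J := by
    intro i j k h hki hkj hm
    apply opp j k hkj.symm
    refine offdiag hJ hkj.symm (B1_mem hJ (tr_single hki) hm) ?_
    rw [B_left1]
    simp [elt, Matrix.single_mul_single_of_ne, hkj.symm]
  have left' : ∀ i j k : Fin 3, i ≠ j → k ≠ j → elt F (Matrix.single i j 1) 0 0 0 ∈ J →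
      elt F (Matrix.single k j 1) 0 0 0 ∈ J := by
    intro i j k h hkj hm
    by_cases hki : k = i
    · rw [hki]; exact hm
    · exact left i j k h hki hkj hm
  by_cases hrj : r = j
  · subst hrj
    by_cases hsi : s = i
    · subst hsi; exact opp _ _ h hm
    · exact opp _ _ hrs.symm (left' _ _ s h hrs.symm hm)
  · have h1 := left' i j r h hrj hm
    exact opp _ _ hrs.symm (left' j r s (Ne.symm hrj) hrs.symm (opp _ _ hrj h1))

lemma elt_add (a b : gl3 F) (x f : T3 F) (a' b' : gl3 F) (x' f' : T3 F) :
    elt F a b x f + elt F a' b' x' f' = elt F (a + a') (b + b') (x + x') (f + f') := rfl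

lemma all_sl1 (hJ : IdealLike J)
    (hr : ∀ r s : Fin 3, r ≠ s → elt F (Matrix.single r s 1) 0 0 0 ∈ J)
    (a : gl3 F) (ha : trace a = 0) : elt F a 0 0 0 ∈ J := by
  let φ : gl3 F →ₗ[F] Mbig F :=
    { toFun := fun a => elt F a 0 0 0
      map_add' := fun a b => by simp [elt]
      map_smul' := fun c a => by simp [elt] }
  have hd : ∀ r s : Fin 3, r ≠ s →
      elt F (Matrix.single r r 1 - Matrix.single s s 1) 0 0 0 ∈ J := by
    intro r s h
    have h1 := B1_mem hJ (tr_single h) (hr s r h.symm)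
    rw [B_left1] at h1
    have h2 : act1 F (Matrix.single r s 1) 0 = 0 := by funext i j k; simp [act1]
    have h3 : coact1 F (Matrix.single r s 1) 0 = 0 := by funext i j k; simp [coact1]
    simpa [elt, h2, h3] using h1
  show φ a ∈ J
  have e : a = a 0 1 • Matrix.single 0 1 1 + a 0 2 • Matrix.single 0 2 1
      + a 1 0 • Matrix.single 1 0 1 + a 1 2 • Matrix.single 1 2 1
      + a 2 0 • Matrix.single 2 0 1 + a 2 1 • Matrix.single 2 1 1
      + a 0 0 • (Matrix.single 0 0 1 - Matrix.single 2 2 1)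
      + a 1 1 • (Matrix.single 1 1 1 - Matrix.single 2 2 1) := by
    rw [Matrix.trace_fin_three] at ha
    ext i j
    fin_cases i <;> fin_cases j <;> simp [Matrix.single_apply]
    linear_combination ha
  rw [e]
  simp only [map_add, map_smul]
  refine J.add_mem (J.add_mem (J.add_mem (J.add_mem (J.add_mem (J.add_mem (J.add_mem ?_ ?_) ?_)
    ?_) ?_) ?_) ?_) ?_ <;> apply J.smul_mem
  · exact hr 0 1 (by decide)
  · exact hr 0 2 (by decide)
  · exact hr 1 0 (by decide)
  · exact hr 1 2 (by decide)
  · exact hr 2 0 (by decide)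
  · exact hr 2 1 (by decide)
  · exact hd 0 2 (by decide)
  · exact hd 1 2 (by decide)

/-- Bracket of a symmetric tensor with an element of `sl(X₁)`. -/
lemma B_right1 (c : gl3 F) (y g : T3 F) :
    B F (elt F 0 0 y g) (elt F c 0 0 0) = -elt F 0 0 (act1 F c y) (coact1 F c g) := by
  unfold B elt
  simp only [pair1_zl, pair1_zr, pair2_zl, pair2_zr, pair3_zl, pair3_zr, wedge_zr, act_zr,
    coact_zr, add_zero, sub_zero, zero_mul, mul_zero, zero_sub]
  refine Prod.ext (by simp) (Prod.ext ?_ ?_)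
  · funext i j k; simp [actT, act1]
  · funext i j k; simp [coactT, coact1]

lemma all_V (hJ : IdealLike J)
    (hr : ∀ r s : Fin 3, r ≠ s → elt F (Matrix.single r s 1) 0 0 0 ∈ J)
    (x f : T3 F) (hx : ∀ i j k, x i j k = x i k j) (hf : ∀ i j k, f i j k = f i k j) :
    elt F 0 0 x f ∈ J := by
  have piece : ∀ r : Fin 3, elt F 0 0 (fun i j k => if i = r then x r j k else 0) 0 ∈ J := by
    intro r
    obtain ⟨s, hs⟩ := exists_ne3 r
    have h1 := hJ.2 0 0 (fun i j k => if i = s then x r j k else 0) 0 (by simp) (by simp)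
      (by intro i j k; simp only [hx r j k]) (by simp) _ (hr r s hs)
    rw [B_right1] at h1
    have h2 := J.neg_mem h1
    rw [neg_neg] at h2
    convert h2 using 2
    · funext i j k
      simp [act1, Matrix.single_apply, eq_comm, ite_and]
    · funext i j k; simp [coact1]
  have piece' : ∀ r : Fin 3, elt F 0 0 0 (fun i j k => if i = r then f r j k else 0) ∈ J := by
    intro r
    obtain ⟨s, hs⟩ := exists_ne3 r
    have h1 := hJ.2 0 0 0 (fun i j k => if i = s then f r j k else 0) (by simp) (by simp)
      (by simp) (by intro i j k; simp only [hf r j k]) _ (hr s r hs.symm)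
    rw [B_right1] at h1
    convert h1 using 1
    show elt F _ _ _ _ = ((-0, -0, -0), (-act1 F _ 0, -coact1 F _ _))
    refine Prod.ext (by simp [elt]) (Prod.ext ?_ ?_)
    · funext i j k; simp [act1, elt]
    · funext i j k
      simp [coact1, elt, Matrix.single_apply, eq_comm, ite_and]
  have := J.add_mem (J.add_mem (J.add_mem (piece 0) (piece 1)) (piece 2))
    (J.add_mem (J.add_mem (piece' 0) (piece' 1)) (piece' 2))
  simp only [elt_add] at this
  convert this using 2
  · simp
  · simp
  · funext i j k; fin_cases i <;> simp
  · funext i j k; fin_cases i <;> simp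

lemma all_sl2 (hJ : IdealLike J) (hs : ∀ a : gl3 F, trace a = 0 → elt F a 0 0 0 ∈ J)
    (hV : ∀ x f : T3 F, (∀ i j k, x i j k = x i k j) → (∀ i j k, f i j k = f i k j) →
      elt F 0 0 x f ∈ J) (b : gl3 F) (hb : trace b = 0) : elt F 0 b 0 0 ∈ J := by
  have piece : ∀ s : Fin 3, elt F 0
      (Matrix.of fun p q => (if q = s then b p s else 0) - (1/3) * (if p = q then b s s else 0))
      0 0 ∈ J := by
    intro s
    let y : T3 F := fun i p q => if i = 0 then
      (if q = s then b p s else if p = s then b q s else 0) else 0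
    have hy : ∀ i j k, y i j k = y i k j := by
      intro i j k
      by_cases h1 : k = s <;> by_cases h2 : j = s <;> simp [y, h1, h2]
    have h1 := hJ.2 0 0 0 (symT 0 s s) (by simp) (by simp) (by simp) (symT_symm 0 s s) _
      (hV y 0 hy (by simp))
    have h2 := J.sub_mem h1 (hs (pair1 F (symT 0 s s) y) (trace_pair1 F _ _))
    have hy0 : ∀ p, y 0 p s = b p s := fun p => by simp [y]
    have hy1 : ∀ p, y 0 s p = b p s := fun p => by rw [hy, hy0]
    have ht : tpair F (symT 0 s s) y = b s s := by
      simp [tpair, symT, ite_and, hy0]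
    convert h2 using 1
    refine Prod.ext (Prod.ext ?_ (Prod.ext ?_ ?_)) (Prod.ext ?_ ?_)
    · simp [B, elt, pair1_zl]
    · ext p q
      simp [B, elt, tpair_zl, pair2, ht, symT, hy0, ite_and]
    · ext p q
      simp [B, elt, tpair_zl, pair3, ht, symT, hy1, ite_and]
    · simp [B, elt, wedge_zr, act_zr, act_zl]
    · simp [B, elt, wedge_zl, coact_zr, coact_zl]
  have := J.add_mem (J.add_mem (piece 0) (piece 1)) (piece 2)
  simp only [elt_add] at this
  convert this using 2
  · simp
  · rw [Matrix.trace_fin_three] at hb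
    ext p q
    fin_cases p <;> fin_cases q <;> simp <;> linear_combination (1/3) * hb
  · simp
  · simp

lemma ideal_all (hJ : IdealLike J) (hne : J ≠ ⊥) (v : Mbig F) (hv : v ∈ Lsub F)
    (hv' : tau F v = v) : v ∈ J := by
  obtain ⟨w, hw, hw0⟩ := Submodule.exists_mem_ne_zero_of_ne_bot hne
  obtain ⟨i, j, hij, hm⟩ := step_b hJ hw hw0
  have hr := all_roots hJ hij hm
  have h1 := all_sl1 hJ hr
  have h2 := all_V hJ hr
  have h3 := all_sl2 hJ h1 h2
  obtain ⟨e1, e2, e3⟩ := fixed_form F hv'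
  have := J.add_mem (J.add_mem (h1 v.1.1 hv.1.1) (h3 v.1.2.1 hv.1.2.1)) (h2 _ _ e2 e3)
  simp only [elt_add, add_zero, zero_add] at this
  convert this using 1
  refine Prod.ext (Prod.ext rfl (Prod.ext rfl ?_)) rfl
  exact e1.symm

end ideal

lemma mem_Ltau {u : ↥(Lsub F)} : u ∈ Ltau F ↔ tau F (u : Mbig F) = u := by
  simp [Ltau, sub_eq_zero]

/-! ### Dimension -/

/-- Coordinates on trace-zero matrices. -/
def mat8 : (Fin 8 → F) →ₗ[F] gl3 F where
  toFun c := !![c 0, c 1, c 2; c 3, c 4, c 5; c 6, c 7, -(c 0 + c 4)]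
  map_add' c d := by
    ext i j; fin_cases i <;> fin_cases j <;> simp <;> ring
  map_smul' r c := by
    ext i j; fin_cases i <;> fin_cases j <;> simp <;> ring

/-- Index of a symmetric pair. -/
def sidx : Fin 3 → Fin 3 → Fin 6 := ![![0, 1, 2], ![1, 3, 4], ![2, 4, 5]]

lemma sidx_symm : ∀ j k, sidx j k = sidx k j := by decide

/-- Coordinates on symmetric tensors. -/
def ten : (Fin 3 → Fin 6 → F) →ₗ[F] T3 F where
  toFun c := fun i j k => c i (sidx j k)
  map_add' c d := rfl
  map_smul' r c := rfl

/-- Parametrisation of `L^τ`. -/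
def param : ((Fin 8 → F) × (Fin 8 → F) × (Fin 3 → Fin 6 → F) × (Fin 3 → Fin 6 → F)) ≃ₗ[F]
    ↥(Ltau F) where
  toFun p := ⟨⟨elt F (mat8 F p.1) (mat8 F p.2.1) (ten F p.2.2.1) (ten F p.2.2.2),
      elt_mem F (by simp [mat8, Matrix.trace_fin_three]) (by simp [mat8, Matrix.trace_fin_three])⟩,
    (mem_Ltau F).2 (elt_tau F (fun i j k => by simp [ten, sidx_symm j k])
      (fun i j k => by simp [ten, sidx_symm j k]))⟩
  map_add' p q := by
    apply Subtype.ext; apply Subtype.ext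
    simp [elt]
  map_smul' r p := by
    apply Subtype.ext; apply Subtype.ext
    simp [elt]
  invFun u :=
    let a := u.1.1.1.1
    let b := u.1.1.1.2.1
    let x := u.1.1.2.1
    let f := u.1.1.2.2
    (![a 0 0, a 0 1, a 0 2, a 1 0, a 1 1, a 1 2, a 2 0, a 2 1],
     ![b 0 0, b 0 1, b 0 2, b 1 0, b 1 1, b 1 2, b 2 0, b 2 1],
     (fun i => ![x i 0 0, x i 0 1, x i 0 2, x i 1 1, x i 1 2, x i 2 2]),
     (fun i => ![f i 0 0, f i 0 1, f i 0 2, f i 1 1, f i 1 2, f i 2 2]))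
  left_inv p := by
    refine Prod.ext ?_ (Prod.ext ?_ (Prod.ext ?_ ?_))
    · funext i; fin_cases i <;> simp [elt, mat8]
    · funext i; fin_cases i <;> simp [elt, mat8]
    · funext i j; fin_cases j <;> simp [elt, ten, sidx]
    · funext i j; fin_cases j <;> simp [elt, ten, sidx]
  right_inv u := by
    obtain ⟨⟨v, hv⟩, hu⟩ := u
    obtain ⟨e1, e2, e3⟩ := fixed_form F ((mem_Ltau F).1 hu)
    have t1 : trace v.1.1 = 0 := hv.1.1
    have t2 : trace v.1.2.1 = 0 := hv.1.2.1
    apply Subtype.ext; apply Subtype.ext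
    simp only at e1 e2 e3
    rw [Matrix.trace_fin_three] at t1 t2
    have k2 : mat8 F ![v.1.2.1 0 0, v.1.2.1 0 1, v.1.2.1 0 2, v.1.2.1 1 0, v.1.2.1 1 1,
        v.1.2.1 1 2, v.1.2.1 2 0, v.1.2.1 2 1] = v.1.2.1 := by
      ext i j; fin_cases i <;> fin_cases j <;> simp [mat8]
      linear_combination -t2
    refine Prod.ext (Prod.ext ?_ (Prod.ext ?_ ?_)) (Prod.ext ?_ ?_)
    · ext i j; fin_cases i <;> fin_cases j <;> simp [mat8, elt]
      linear_combination -t1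
    · exact k2
    · exact k2.trans e1
    · funext i j k; fin_cases j <;> fin_cases k <;> simp [elt, ten, sidx] <;> exact e2 _ _ _
    · funext i j k; fin_cases j <;> fin_cases k <;> simp [elt, ten, sidx] <;> exact e3 _ _ _

lemma finrank_Ltau : Module.finrank F ↥(Ltau F) = 52 := by
  rw [← (param F).finrank_eq]
  simp [Module.finrank_pi_fintype]

/-- `τ` is a Lie algebra automorphism of `L ≅ e₆` of order 2, whose fixed
subalgebra `L^τ` has dimension 52 and is a simple Lie algebra (a model of `f₄`). -/
theorem e6_fold_to_f4 :
    -- τ preserves L and its bracket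
    (∀ u ∈ Lsub F, tau F u ∈ Lsub F) ∧
    (∀ u v : ↥(Lsub F), tau F (B F ↑u ↑v) = B F (tau F ↑u) (tau F ↑v)) ∧
    -- τ has order exactly 2
    (∀ u : ↥(Lsub F), tau F (tau F ↑u) = ↑u) ∧ (∃ u : ↥(Lsub F), tau F ↑u ≠ ↑u) ∧
    -- the fixed subalgebra has dimension 52
    Module.finrank F ↥(Ltau F) = 52 ∧
    -- and is a simple Lie algebra: it is nonabelian and has no proper nonzero ideals
    (∃ u ∈ Ltau F, ∃ v ∈ Ltau F, Bsub F u v ≠ 0) ∧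
    (∀ I : Submodule F ↥(Lsub F), I ≤ Ltau F →
      (∀ u ∈ Ltau F, ∀ v ∈ I, Bsub F u v ∈ I) → I = ⊥ ∨ I = Ltau F) := by
  refine ⟨?_, fun u v => tau_B F u v, fun u => rfl, ?_, finrank_Ltau F, ?_, ?_⟩
  · intro u hu
    exact ⟨⟨hu.1.1, hu.1.2.2, hu.1.2.1⟩, trivial, trivial⟩
  · refine ⟨⟨((0, Matrix.single 0 1 1, 0), (0, 0)),
      ⟨by simp [sl3], tr_single (by decide), by simp [sl3]⟩, trivial, trivial⟩, fun h => ?_⟩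
    have h1 := congrFun (congrFun (fixed_form F h).1 0) 1
    simp at h1
  · refine ⟨⟨elt F (Matrix.single 0 1 1) 0 0 0, elt_mem F (tr_single (by decide)) (by simp)⟩,
      (mem_Ltau F).2 (elt_tau F (by simp) (by simp)),
      ⟨elt F (Matrix.single 1 0 1) 0 0 0, elt_mem F (tr_single (by decide)) (by simp)⟩,
      (mem_Ltau F).2 (elt_tau F (by simp) (by simp)), fun h => ?_⟩
    have h1 : B F (elt F (Matrix.single 0 1 1) 0 0 0) (elt F (Matrix.single 1 0 1) 0 0 0) = 0 :=
      congrArg Subtype.val h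
    rw [B_left1] at h1
    have h2 := congrFun (congrFun (congrArg (fun w : Mbig F => w.1.1) h1) 0) 0
    simp [elt, Matrix.single_apply] at h2
  · intro I hI hid
    by_cases hb : I = ⊥
    · exact Or.inl hb
    right
    have hJ : IdealLike (I.map (Lsub F).subtype) := by
      refine ⟨?_, ?_⟩
      · rintro _ ⟨u, hu, rfl⟩
        exact ⟨u.2, (mem_Ltau F).1 (hI hu)⟩
      · rintro a b x f ha hb hx hf _ ⟨u, hu, rfl⟩
        exact ⟨_, hid ⟨elt F a b x f, elt_mem F ha hb⟩
          ((mem_Ltau F).2 (elt_tau F hx hf)) u hu, rfl⟩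
    refine le_antisymm hI fun u hu => ?_
    obtain ⟨w, hw, hwu⟩ := ideal_all hJ (fun h => hb (Submodule.map_injective_of_injective
      (Subtype.val_injective : Function.Injective (Lsub F).subtype) (h.trans (Submodule.map_bot _).symm))) u u.2 ((mem_Ltau F).1 hu)
    rwa [← Subtype.ext hwu]

end
end
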